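/- There exist ε₀ > 0 and C > 0 such that if 0 < ε < ε₀, f is a (1+ε)-biLipschitz map of ℍ, R > 0 and P₀ ∈ ℍ is a fixed point, then there exists an isometry T of (ℍ,d) such that d(f(P), T(P)) ≤ C ε^{1/2048} R for every P ∈ ℍ with d(P,P₀) ≤ R. -/

import Mathlib

noncomputable section

open MeasureTheory

/-- Points of the Heisenberg group `ℍ`, identified with `ℝ³ ≅ ℂ × ℝ`:
`(x, y, t)` corresponds to `(z ; t)` with `z = x + iy`. -/
abbrev H : Type := ℝ × ℝ × ℝ

/-- The Heisenberg group law
`(x,y,t)·(x',y',t') = (x+x', y+y', t+t'+2(x'y − xy'))`. -/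
def Hmul (p q : H) : H :=
  (p.1 + q.1, p.2.1 + q.2.1, p.2.2 + q.2.2 + 2 * (q.1 * p.2.1 - p.1 * q.2.1))

/-- The Heisenberg group inverse. -/
def Hinv (p : H) : H := (-p.1, -p.2.1, -p.2.2)

/-- The identity `O = (0,0,0)`. -/
def HO : H := (0, 0, 0)

/-- The control (Carnot–Carathéodory) distance: the infimum of the lengths
`∫₀¹ √(a(s)² + b(s)²) ds` of horizontal Lipschitz curves `γ` joining `P` to `Q`,
i.e. curves satisfying a.e. `γ' = a·X(γ) + b·Y(γ)` where `X = ∂ₓ + 2y∂_t` and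
`Y = ∂_y − 2x∂_t`. -/
def dH (P Q : H) : ℝ :=
  sInf { L : ℝ | ∃ (γ : ℝ → H) (a b : ℝ → ℝ) (K : NNReal),
    LipschitzWith K γ ∧ γ 0 = P ∧ γ 1 = Q ∧
    (∀ᵐ s ∂volume, s ∈ Set.Icc (0:ℝ) 1 →
      HasDerivAt γ (a s, b s, 2 * (γ s).2.1 * a s - 2 * (γ s).1 * b s) s) ∧
    IntervalIntegrable (fun s => Real.sqrt (a s ^ 2 + b s ^ 2)) volume 0 1 ∧
    L = ∫ s in (0:ℝ)..1, Real.sqrt (a s ^ 2 + b s ^ 2) }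

/-- `γ : ℝ → ℍ` is a `(1+ε)`-quasigeodesic. -/
def IsQuasiGeodesic (ε : ℝ) (γ : ℝ → H) : Prop :=
  ∀ s s' : ℝ, (1 + ε)⁻¹ * |s - s'| ≤ dH (γ s) (γ s') ∧
    dH (γ s) (γ s') ≤ (1 + ε) * |s - s'|

/-- `f : ℍ → ℍ` is `(1+ε)`-biLipschitz for the control distance. -/
def IsBiLip (ε : ℝ) (f : H → H) : Prop :=
  ∀ P Q : H, (1 + ε)⁻¹ * dH P Q ≤ dH (f P) (f Q) ∧ dH (f P) (f Q) ≤ (1 + ε) * dH P Q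

/-- `(a,b)` is the horizontal speed of `γ`: a.e. `γ'(s) = a(s)X(γ(s)) + b(s)Y(γ(s))`. -/
def HasHorizSpeed (γ : ℝ → H) (a b : ℝ → ℝ) : Prop :=
  ∀ᵐ s ∂volume, HasDerivAt γ (a s, b s, 2 * (γ s).2.1 * a s - 2 * (γ s).1 * b s) s


open Set

/-! ### Part 1: analysis of horizontal curves -/

def Lip (f : ℝ → ℝ) : Prop :=
  ∃ K : ℝ, ∀ s ∈ Icc (0:ℝ) 1, ∀ s' ∈ Icc (0:ℝ) 1, |f s - f s'| ≤ K * |s - s'|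

lemma Lip.exists_nonneg {f : ℝ → ℝ} (h : Lip f) : ∃ K : ℝ, 0 ≤ K ∧
    ∀ s ∈ Icc (0:ℝ) 1, ∀ s' ∈ Icc (0:ℝ) 1, |f s - f s'| ≤ K * |s - s'| := by
  obtain ⟨K, hK⟩ := h
  refine ⟨|K|, abs_nonneg _, fun s hs s' hs' => (hK s hs s' hs').trans ?_⟩
  exact mul_le_mul_of_nonneg_right (le_abs_self K) (abs_nonneg _)

lemma Lip.const (c : ℝ) : Lip (fun _ => c) := ⟨0, by simp⟩

lemma Lip.add {f g : ℝ → ℝ} (hf : Lip f) (hg : Lip g) : Lip (fun s => f s + g s) := by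
  obtain ⟨K, hK⟩ := hf
  obtain ⟨K', hK'⟩ := hg
  refine ⟨K + K', fun s hs s' hs' => ?_⟩
  have h1 := hK s hs s' hs'
  have h2 := hK' s hs s' hs'
  have h3 : f s + g s - (f s' + g s') = (f s - f s') + (g s - g s') := by ring
  rw [h3, add_mul]
  exact (abs_add_le _ _).trans (add_le_add h1 h2)

lemma Lip.bdd {f : ℝ → ℝ} (hf : Lip f) : ∃ B : ℝ, 0 ≤ B ∧ ∀ s ∈ Icc (0:ℝ) 1, |f s| ≤ B := by
  obtain ⟨K, hK0, hK⟩ := hf.exists_nonneg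
  refine ⟨|f 0| + K, by positivity, fun s hs => ?_⟩
  have h1 := hK s hs 0 (by simp)
  have h2 : |s - 0| ≤ 1 := by rw [sub_zero, abs_of_nonneg hs.1]; exact hs.2
  have h3 : f s = f 0 + (f s - f 0) := by ring
  rw [h3]
  refine (abs_add_le _ _).trans (add_le_add le_rfl (h1.trans ?_))
  nlinarith

lemma Lip.mul {f g : ℝ → ℝ} (hf : Lip f) (hg : Lip g) : Lip (fun s => f s * g s) := by
  obtain ⟨B, hB0, hB⟩ := hf.bdd
  obtain ⟨B', hB0', hB'⟩ := hg.bdd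
  obtain ⟨K, hK⟩ := hf
  obtain ⟨K', hK'⟩ := hg
  refine ⟨B * K' + K * B', fun s hs s' hs' => ?_⟩
  have h1 := hK s hs s' hs'
  have h2 := hK' s hs s' hs'
  have h3 : f s * g s - f s' * g s' = f s * (g s - g s') + (f s - f s') * g s' := by ring
  rw [h3]
  refine (abs_add_le _ _).trans ?_
  rw [abs_mul, abs_mul]
  have e1 : |f s| * |g s - g s'| ≤ B * (K' * |s - s'|) :=
    mul_le_mul (hB s hs) h2 (abs_nonneg _) hB0
  have e2 : |f s - f s'| * |g s'| ≤ (K * |s - s'|) * B' :=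
    mul_le_mul h1 (hB' s' hs') (abs_nonneg _) ((abs_nonneg _).trans h1)
  nlinarith

lemma Lip.lipOn {f : ℝ → ℝ} (hf : Lip f) : ∃ K : NNReal, LipschitzOnWith K f (Icc 0 1) := by
  obtain ⟨K, hK0, hK⟩ := hf.exists_nonneg
  refine ⟨⟨K, hK0⟩, LipschitzOnWith.of_dist_le_mul fun s hs s' hs' => ?_⟩
  rw [Real.dist_eq, Real.dist_eq]
  exact hK s hs s' hs'

lemma Lip.ac {f : ℝ → ℝ} (hf : Lip f) {r r' : ℝ} (hr : r ∈ Icc (0:ℝ) 1) (hr' : r' ∈ Icc (0:ℝ) 1) :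
    AbsolutelyContinuousOnInterval f r r' := by
  obtain ⟨K, hK⟩ := hf.lipOn
  apply LipschitzOnWith.absolutelyContinuousOnInterval (K := K)
  exact hK.mono (uIcc_subset_Icc hr hr')

lemma Lip.deriv_bdd {f : ℝ → ℝ} (hf : Lip f) : ∃ K : ℝ, 0 ≤ K ∧ ∀ s ∈ Ioo (0:ℝ) 1, ∀ g,
    HasDerivAt f g s → |g| ≤ K := by
  obtain ⟨K, hK0, hK⟩ := hf.exists_nonneg
  refine ⟨K, hK0, fun s hs g hg => ?_⟩
  have hn : ∀ᶠ x in nhds s, ‖f x - f s‖ ≤ K * ‖x - s‖ := by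
    filter_upwards [Ioo_mem_nhds hs.1 hs.2] with x hx
    exact hK x ⟨hx.1.le, hx.2.le⟩ s ⟨hs.1.le, hs.2.le⟩
  have := hg.le_of_lip' hK0 hn
  simpa using this

lemma ae_ne (c : ℝ) : ∀ᵐ s : ℝ, s ≠ c := by simp [ae_iff, measure_singleton]

lemma Lip.ftc {f g : ℝ → ℝ} (hf : Lip f) (h : ∀ᵐ s ∂volume, s ∈ Icc (0:ℝ) 1 → HasDerivAt f (g s) s)
    {r r' : ℝ} (hr : r ∈ Icc (0:ℝ) 1) (hr' : r' ∈ Icc (0:ℝ) 1) :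
    IntervalIntegrable g volume r r' ∧ ∫ s in r..r', g s = f r' - f r := by
  have hac := hf.ac hr hr'
  have hae : ∀ᵐ s ∂volume, s ∈ uIoc r r' → deriv f s = g s := by
    filter_upwards [h] with s hs hs'
    exact (hs (uIcc_subset_Icc hr hr' (uIoc_subset_uIcc hs'))).deriv
  constructor
  · refine hac.intervalIntegrable_deriv.congr_ae ?_
    exact (ae_restrict_iff' measurableSet_uIoc).2 hae
  · rw [← hac.integral_deriv_eq_sub]
    exact intervalIntegral.integral_congr_ae (by filter_upwards [hae] with s hs hs'; exact (hs hs').symm)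

lemma Lip.integral {g : ℝ → ℝ} {B : ℝ} (hg : IntervalIntegrable g volume 0 1)
    (hB : ∀ᵐ s ∂volume, s ∈ Icc (0:ℝ) 1 → |g s| ≤ B) :
    Lip (fun s => ∫ u in (0:ℝ)..s, g u) := by
  refine ⟨B, fun s hs s' hs' => ?_⟩
  have i1 : IntervalIntegrable g volume 0 s := hg.mono_set (by
    rw [uIcc_of_le hs.1, uIcc_of_le zero_le_one]; exact Icc_subset_Icc le_rfl hs.2)
  have i2 : IntervalIntegrable g volume 0 s' := hg.mono_set (by
    rw [uIcc_of_le hs'.1, uIcc_of_le zero_le_one]; exact Icc_subset_Icc le_rfl hs'.2)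
  rw [intervalIntegral.integral_interval_sub_left i1 i2]
  have := intervalIntegral.norm_integral_le_of_norm_le_const_ae (a := s') (b := s) (f := g) (C := B) (by
    filter_upwards [hB] with u hu hu'
    exact hu (uIcc_subset_Icc hs' hs (uIoc_subset_uIcc hu')))
  exact this

lemma hasDeriv_integral {g : ℝ → ℝ} (hg : IntervalIntegrable g volume 0 1) :
    ∀ᵐ s ∂volume, s ∈ Icc (0:ℝ) 1 → HasDerivAt (fun s => ∫ u in (0:ℝ)..s, g u) (g s) s := by
  filter_upwards [hg.ae_hasDerivAt_integral] with s hs hs'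
  exact hs (by rwa [uIcc_of_le zero_le_one]) 0 (by simp)

def sp (a b : ℝ → ℝ) : ℝ → ℝ := fun s => Real.sqrt (a s ^ 2 + b s ^ 2)

structure Cv (x y t a b : ℝ → ℝ) : Prop where
  lx : Lip x
  ly : Lip y
  lt : Lip t
  dx : ∀ᵐ s ∂volume, s ∈ Icc (0:ℝ) 1 → HasDerivAt x (a s) s
  dy : ∀ᵐ s ∂volume, s ∈ Icc (0:ℝ) 1 → HasDerivAt y (b s) s
  dt : ∀ᵐ s ∂volume, s ∈ Icc (0:ℝ) 1 → HasDerivAt t (2 * y s * a s - 2 * x s * b s) s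

lemma sp_nonneg (a b : ℝ → ℝ) (s : ℝ) : 0 ≤ sp a b s := Real.sqrt_nonneg _

lemma sqrt_le_abs_add (a b : ℝ) : Real.sqrt (a ^ 2 + b ^ 2) ≤ |a| + |b| := by
  apply Real.sqrt_le_iff.2
  constructor
  · positivity
  · nlinarith [sq_abs a, sq_abs b, abs_nonneg a, abs_nonneg b]

lemma Cv.sp_int {x y t a b : ℝ → ℝ} (h : Cv x y t a b) : IntervalIntegrable (sp a b) volume 0 1 := by
  have ia := (h.lx.ftc h.dx (r := 0) (r' := 1) (by simp) (by simp)).1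
  have ib := (h.ly.ftc h.dy (r := 0) (r' := 1) (by simp) (by simp)).1
  refine (ia.abs.add ib.abs).mono_fun ?_ ?_
  · have := (ia.aestronglyMeasurable.pow 2).add (ib.aestronglyMeasurable.pow 2)
    have h2 : Continuous Real.sqrt := Real.continuous_sqrt
    have h3 := h2.comp_aestronglyMeasurable this
    rw [uIoc_of_le zero_le_one]
    exact h3
  · refine Filter.Eventually.of_forall fun s => ?_
    show ‖sp a b s‖ ≤ ‖|a s| + |b s|‖
    rw [Real.norm_of_nonneg (sp_nonneg _ _ _), Real.norm_of_nonneg (by positivity)]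
    exact sqrt_le_abs_add _ _

lemma Cv.sp_bdd {x y t a b : ℝ → ℝ} (h : Cv x y t a b) : ∃ B : ℝ, 0 ≤ B ∧
    ∀ᵐ s ∂volume, s ∈ Icc (0:ℝ) 1 → |sp a b s| ≤ B := by
  obtain ⟨K, hK0, hK⟩ := h.lx.deriv_bdd
  obtain ⟨K', hK0', hK'⟩ := h.ly.deriv_bdd
  refine ⟨K + K', by positivity, ?_⟩
  filter_upwards [h.dx, h.dy, ae_ne 0, ae_ne 1] with s h1 h2 h3 h4 hs
  have hs' : s ∈ Ioo (0:ℝ) 1 := ⟨lt_of_le_of_ne hs.1 (Ne.symm h3), lt_of_le_of_ne hs.2 h4⟩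
  rw [abs_of_nonneg (sp_nonneg _ _ _)]
  exact (sqrt_le_abs_add _ _).trans (add_le_add (hK s hs' _ (h1 hs)) (hK' s hs' _ (h2 hs)))

def IsLen (P Q : H) (L : ℝ) : Prop := ∃ x y t a b : ℝ → ℝ, Cv x y t a b ∧
  (x 0, y 0, t 0) = P ∧ (x 1, y 1, t 1) = Q ∧ L = ∫ s in (0:ℝ)..1, sp a b s

lemma isLen_iff (P Q : H) (L : ℝ) : IsLen P Q L ↔ ∃ (γ : ℝ → H) (a b : ℝ → ℝ) (K : NNReal),
    LipschitzWith K γ ∧ γ 0 = P ∧ γ 1 = Q ∧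
    (∀ᵐ s ∂volume, s ∈ Set.Icc (0:ℝ) 1 →
      HasDerivAt γ (a s, b s, 2 * (γ s).2.1 * a s - 2 * (γ s).1 * b s) s) ∧
    IntervalIntegrable (fun s => Real.sqrt (a s ^ 2 + b s ^ 2)) volume 0 1 ∧
    L = ∫ s in (0:ℝ)..1, Real.sqrt (a s ^ 2 + b s ^ 2) := by
  constructor
  · rintro ⟨x, y, t, a, b, h, h0, h1, hL⟩
    obtain ⟨K1, hK1⟩ := h.lx.lipOn
    obtain ⟨K2, hK2⟩ := h.ly.lipOn
    obtain ⟨K3, hK3⟩ := h.lt.lipOn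
    have key : ∀ (f : ℝ → ℝ) (K : NNReal), LipschitzOnWith K f (Icc 0 1) →
        LipschitzWith K (fun s => f ((projIcc 0 1 zero_le_one s : Icc (0:ℝ) 1) : ℝ)) := by
      intro f K hf
      have := (hf.to_restrict).comp (LipschitzWith.projIcc (zero_le_one (α := ℝ)))
      rw [mul_one] at this
      exact this
    refine ⟨fun s => (x ((projIcc 0 1 zero_le_one s : Icc (0:ℝ) 1) : ℝ),
      y ((projIcc 0 1 zero_le_one s : Icc (0:ℝ) 1) : ℝ),
      t ((projIcc 0 1 zero_le_one s : Icc (0:ℝ) 1) : ℝ)), a, b, _, (key x K1 hK1).prodMk ((key y K2 hK2).prodMk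
      (key t K3 hK3)), ?_, ?_, ?_, h.sp_int, hL⟩
    · simpa using h0
    · simpa using h1
    · filter_upwards [h.dx, h.dy, h.dt, ae_ne 0, ae_ne 1] with s h1 h2 h3 h4 h5 hs
      have hs' : s ∈ Ioo (0:ℝ) 1 := ⟨lt_of_le_of_ne hs.1 (Ne.symm h4), lt_of_le_of_ne hs.2 h5⟩
      have hp : ((projIcc 0 1 zero_le_one s : Icc (0:ℝ) 1) : ℝ) = s := by
        rw [projIcc_of_mem _ hs]
      simp only [hp]
      have hd := (h1 hs).prodMk ((h2 hs).prodMk (h3 hs))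
      refine hd.congr_of_eventuallyEq ?_
      filter_upwards [Ioo_mem_nhds hs'.1 hs'.2] with u hu
      rw [projIcc_of_mem _ ⟨hu.1.le, hu.2.le⟩]
  · rintro ⟨γ, a, b, K, hγ, h0, h1, hd, hi, hL⟩
    have key : ∀ (φ : H → ℝ), LipschitzWith 1 φ → Lip (fun s => φ (γ s)) := by
      intro φ hφ
      refine ⟨K, fun s _ s' _ => ?_⟩
      have := (hφ.comp hγ).dist_le_mul s s'
      simpa [Real.dist_eq] using this
    have k1 : LipschitzWith 1 (fun p : H => p.1) := LipschitzWith.prod_fst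
    have k2 : LipschitzWith 1 (fun p : H => p.2.1) := by
      have := (LipschitzWith.prod_fst (α := ℝ) (β := ℝ)).comp (LipschitzWith.prod_snd (α := ℝ) (β := ℝ × ℝ))
      rw [mul_one] at this
      exact this
    have k3 : LipschitzWith 1 (fun p : H => p.2.2) := by
      have := (LipschitzWith.prod_snd (α := ℝ) (β := ℝ)).comp (LipschitzWith.prod_snd (α := ℝ) (β := ℝ × ℝ))
      rw [mul_one] at this
      exact this
    refine ⟨fun s => (γ s).1, fun s => (γ s).2.1, fun s => (γ s).2.2, a, b,
      ⟨key _ k1, key _ k2, key _ k3, ?_, ?_, ?_⟩, h0, h1, hL⟩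
    · filter_upwards [hd] with s hs hs'
      exact ((hasFDerivAt_fst (𝕜 := ℝ)).comp_hasDerivAt s (hs hs'))
    · filter_upwards [hd] with s hs hs'
      have e := ((hasFDerivAt_snd (𝕜 := ℝ)).comp_hasDerivAt s (hs hs'))
      exact ((hasFDerivAt_fst (𝕜 := ℝ)).comp_hasDerivAt s e)
    · filter_upwards [hd] with s hs hs'
      have e := ((hasFDerivAt_snd (𝕜 := ℝ)).comp_hasDerivAt s (hs hs'))
      exact ((hasFDerivAt_snd (𝕜 := ℝ)).comp_hasDerivAt s e)

lemma dH_eq_sInf (P Q : H) : dH P Q = sInf {L | IsLen P Q L} := by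
  unfold dH
  congr 1
  ext L
  exact (isLen_iff P Q L).symm

lemma IsLen.nonneg {P Q : H} {L : ℝ} (h : IsLen P Q L) : 0 ≤ L := by
  obtain ⟨x, y, t, a, b, h, h0, h1, hL⟩ := h
  rw [hL]
  exact intervalIntegral.integral_nonneg zero_le_one fun s _ => sp_nonneg _ _ _

lemma IsLen.dH_le {P Q : H} {L : ℝ} (h : IsLen P Q L) : dH P Q ≤ L := by
  rw [dH_eq_sInf]
  exact csInf_le ⟨0, fun L hL => IsLen.nonneg hL⟩ h

lemma dH_nonneg (P Q : H) : 0 ≤ dH P Q := by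
  rw [dH_eq_sInf]
  exact Real.sInf_nonneg fun L hL => IsLen.nonneg hL

/-! ### Part 2: operations on curves -/

lemma Lip.congr {f g : ℝ → ℝ} (hf : Lip f) (h : ∀ s, f s = g s) : Lip g := by
  have : f = g := funext h
  rwa [← this]

lemma Lip.cmul {f : ℝ → ℝ} (c : ℝ) (hf : Lip f) : Lip (fun s => c * f s) := (Lip.const c).mul hf

lemma IsLen.trans_left {P Q : H} {L : ℝ} (g : H) (h : IsLen P Q L) :
    IsLen (Hmul g P) (Hmul g Q) L := by
  obtain ⟨x, y, t, a, b, h, h0, h1, hL⟩ := h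
  refine ⟨fun s => g.1 + x s, fun s => g.2.1 + y s,
    fun s => g.2.2 + t s + 2 * (x s * g.2.1 - g.1 * y s), a, b, ⟨?_, ?_, ?_, ?_, ?_, ?_⟩, ?_, ?_, hL⟩
  · exact (Lip.const _).add h.lx
  · exact (Lip.const _).add h.ly
  · refine ((((Lip.const g.2.2).add h.lt).add (h.lx.cmul (2 * g.2.1))).add
      (h.ly.cmul (-2 * g.1))).congr fun s => ?_
    ring
  · filter_upwards [h.dx] with s hs hs'
    exact (hs hs').const_add _
  · filter_upwards [h.dy] with s hs hs'
    exact (hs hs').const_add _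
  · filter_upwards [h.dx, h.dy, h.dt] with s h1 h2 h3 hs'
    have := ((h3 hs').const_add g.2.2).add ((((h1 hs').mul_const g.2.1).sub
      ((h2 hs').const_mul g.1)).const_mul 2)
    refine this.congr_deriv ?_
    ring
  · rw [← h0]; rfl
  · rw [← h1]; rfl

/-- Similarities. -/
def Sim (p q σ : ℝ) (P : H) : H :=
  (p * P.1 - σ * q * P.2.1, q * P.1 + σ * p * P.2.1, σ * (p ^ 2 + q ^ 2) * P.2.2)

lemma IsLen.sim {P Q : H} {L : ℝ} (p q σ : ℝ) (hσ : σ ^ 2 = 1) (h : IsLen P Q L) :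
    IsLen (Sim p q σ P) (Sim p q σ Q) (Real.sqrt (p ^ 2 + q ^ 2) * L) := by
  obtain ⟨x, y, t, a, b, h, h0, h1, hL⟩ := h
  refine ⟨fun s => p * x s - σ * q * y s, fun s => q * x s + σ * p * y s,
    fun s => σ * (p ^ 2 + q ^ 2) * t s, fun s => p * a s - σ * q * b s,
    fun s => q * a s + σ * p * b s, ⟨?_, ?_, ?_, ?_, ?_, ?_⟩, ?_, ?_, ?_⟩
  · exact ((h.lx.cmul p).add (h.ly.cmul (-(σ * q)))).congr fun s => by ring
  · exact ((h.lx.cmul q).add (h.ly.cmul (σ * p))).congr fun s => by ring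
  · exact h.lt.cmul _
  · filter_upwards [h.dx, h.dy] with s h1 h2 hs'
    exact ((h1 hs').const_mul p).sub ((h2 hs').const_mul (σ * q))
  · filter_upwards [h.dx, h.dy] with s h1 h2 hs'
    exact ((h1 hs').const_mul q).add ((h2 hs').const_mul (σ * p))
  · filter_upwards [h.dt] with s h3 hs'
    refine ((h3 hs').const_mul (σ * (p ^ 2 + q ^ 2))).congr_deriv ?_
    ring
  · rw [← h0]; rfl
  · rw [← h1]; rfl
  · rw [hL, ← intervalIntegral.integral_const_mul]
    congr 1
    ext s
    unfold sp
    rw [← Real.sqrt_mul (by positivity)]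
    congr 1
    have : (p * a s - σ * q * b s) ^ 2 + (q * a s + σ * p * b s) ^ 2
      = (p ^ 2 + q ^ 2) * (a s ^ 2 + σ ^ 2 * b s ^ 2) := by ring
    rw [this, hσ, one_mul]

lemma IsLen.seg (u v : ℝ) : IsLen HO (u, v, 0) (Real.sqrt (u ^ 2 + v ^ 2)) := by
  have lid : Lip (fun s => s) := ⟨1, by simp⟩
  refine ⟨fun s => u * s, fun s => v * s, fun _ => 0, fun _ => u, fun _ => v,
    ⟨lid.cmul u, lid.cmul v, Lip.const 0, ?_, ?_, ?_⟩, ?_, ?_, ?_⟩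
  · refine Filter.Eventually.of_forall fun s _ => ?_
    simpa using (hasDerivAt_id s).const_mul u
  · refine Filter.Eventually.of_forall fun s _ => ?_
    simpa using (hasDerivAt_id s).const_mul v
  · refine Filter.Eventually.of_forall fun s _ => ?_
    refine (hasDerivAt_const s (0:ℝ)).congr_deriv ?_
    ring
  · simp [HO]
  · simp
  · simp [sp]

lemma ae_comp_affine {p : ℝ → Prop} (h : ∀ᵐ s : ℝ, p s) (c d : ℝ) (hc : c ≠ 0) :
    ∀ᵐ s : ℝ, p (c * s + d) := by
  have h1 : ∀ᵐ s : ℝ, p (s + d) := by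
    rw [ae_iff] at h ⊢
    have := measure_preimage_add_right (volume : Measure ℝ) d {a | ¬ p a}
    rw [h] at this
    exact this
  rw [ae_iff] at h1 ⊢
  have := Real.volume_preimage_mul_left hc {a | ¬ p (a + d)}
  rw [h1, mul_zero] at this
  exact this

/-- gluing of functions -/
def glue (f g : ℝ → ℝ) : ℝ → ℝ := fun s => f (min (2 * s) 1) + g (max (2 * s - 1) 0) - f 1

lemma Lip.glue {f g : ℝ → ℝ} (hf : Lip f) (hg : Lip g) : Lip (glue f g) := by
  obtain ⟨K, hK0, hK⟩ := hf.exists_nonneg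
  obtain ⟨K', hK0', hK'⟩ := hg.exists_nonneg
  refine ⟨2 * K + 2 * K', fun s hs s' hs' => ?_⟩
  have m1 : ∀ r ∈ Icc (0:ℝ) 1, min (2 * r) 1 ∈ Icc (0:ℝ) 1 := fun r hr =>
    ⟨le_min (by linarith [hr.1]) zero_le_one, min_le_right _ _⟩
  have m2 : ∀ r ∈ Icc (0:ℝ) 1, max (2 * r - 1) 0 ∈ Icc (0:ℝ) 1 := fun r hr =>
    ⟨le_max_right _ _, max_le (by linarith [hr.2]) zero_le_one⟩
  have h1 := hK _ (m1 s hs) _ (m1 s' hs')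
  have h2 := hK' _ (m2 s hs) _ (m2 s' hs')
  have e1 : |min (2 * s) 1 - min (2 * s') 1| ≤ 2 * |s - s'| := by
    refine (abs_min_sub_min_le_max _ _ _ _).trans ?_
    have : 2 * s - 2 * s' = 2 * (s - s') := by ring
    rw [this, abs_mul]; simp
  have e2 : |max (2 * s - 1) 0 - max (2 * s' - 1) 0| ≤ 2 * |s - s'| := by
    refine (abs_max_sub_max_le_max _ _ _ _).trans ?_
    have : 2 * s - 1 - (2 * s' - 1) = 2 * (s - s') := by ring
    rw [this, abs_mul]; simp
  have e3 : _root_.glue f g s - _root_.glue f g s' = (f (min (2 * s) 1) - f (min (2 * s') 1)) +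
      (g (max (2 * s - 1) 0) - g (max (2 * s' - 1) 0)) := by unfold _root_.glue; ring
  rw [e3]
  refine (abs_add_le _ _).trans ?_
  have := mul_le_mul_of_nonneg_left e1 hK0
  have := mul_le_mul_of_nonneg_left e2 hK0'
  nlinarith

def dglue (f g : ℝ → ℝ) : ℝ → ℝ := fun s => if s < 1 / 2 then 2 * f (2 * s) else 2 * g (2 * s - 1)

lemma glue_left {f g : ℝ → ℝ} (hfg : f 1 = g 0) {s : ℝ} (hs : s ≤ 1 / 2) : glue f g s = f (2 * s) := by
  unfold glue
  rw [min_eq_left (by linarith), max_eq_right (by linarith), hfg]; ring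

lemma glue_right {f g : ℝ → ℝ} {s : ℝ} (hs : 1 / 2 ≤ s) : glue f g s = g (2 * s - 1) := by
  unfold glue
  rw [min_eq_right (by linarith), max_eq_left (by linarith)]; ring

lemma deriv_glue {f g f' g' : ℝ → ℝ} (hfg : f 1 = g 0)
    (hf : ∀ᵐ s ∂volume, s ∈ Icc (0:ℝ) 1 → HasDerivAt f (f' s) s)
    (hg : ∀ᵐ s ∂volume, s ∈ Icc (0:ℝ) 1 → HasDerivAt g (g' s) s) :
    ∀ᵐ s ∂volume, s ∈ Icc (0:ℝ) 1 → HasDerivAt (glue f g) (dglue f' g' s) s := by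
  filter_upwards [ae_comp_affine hf 2 0 two_ne_zero, ae_comp_affine hg 2 (-1) two_ne_zero,
    ae_ne (1/2)] with s h1 h2 h3 hs
  rcases lt_or_gt_of_ne h3 with hlt | hgt
  · have e1 := h1 ⟨by linarith [hs.1], by linarith⟩
    rw [add_zero] at e1
    have e2 : HasDerivAt (fun s : ℝ => 2 * s) 2 s := by simpa using (hasDerivAt_id s).const_mul (2:ℝ)
    have e3 := HasDerivAt.comp s e1 e2
    have e4 : dglue f' g' s = f' (2 * s) * 2 := by unfold dglue; rw [if_pos hlt]; ring
    rw [e4]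
    refine e3.congr_of_eventuallyEq ?_
    filter_upwards [Iio_mem_nhds hlt] with u hu
    exact glue_left hfg (le_of_lt hu)
  · have e1 := h2 ⟨by linarith, by linarith [hs.2]⟩
    have e2 : HasDerivAt (fun s : ℝ => 2 * s + -1) 2 s := by
      simpa using ((hasDerivAt_id s).const_mul (2:ℝ)).add_const (-1)
    have e3 := HasDerivAt.comp s e1 e2
    have e4 : dglue f' g' s = g' (2 * s + -1) * 2 := by
      unfold dglue; rw [if_neg (not_lt.2 hgt.le), sub_eq_add_neg]; ring
    rw [e4]
    refine e3.congr_of_eventuallyEq ?_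
    filter_upwards [Ioi_mem_nhds hgt] with u hu
    rw [glue_right (le_of_lt hu)]; rfl

lemma IsLen.concat {P Q R : H} {L M : ℝ} (h : IsLen P Q L) (h' : IsLen Q R M) : IsLen P R (L + M) := by
  obtain ⟨x, y, t, a, b, h, h0, h1, hL⟩ := h
  obtain ⟨x', y', t', a', b', h', h0', h1', hL'⟩ := h'
  have hQ := h1.trans h0'.symm
  simp only [Prod.mk.injEq] at hQ
  obtain ⟨qx, qy, qt⟩ := hQ
  have hc : Cv (glue x x') (glue y y') (glue t t') (dglue a a') (dglue b b') := by
    refine ⟨h.lx.glue h'.lx, h.ly.glue h'.ly, h.lt.glue h'.lt, deriv_glue qx h.dx h'.dx,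
      deriv_glue qy h.dy h'.dy, ?_⟩
    filter_upwards [deriv_glue qt h.dt h'.dt] with s hs hs'
    refine (hs hs').congr_deriv ?_
    by_cases hlt : s < 1 / 2
    · rw [glue_left qx hlt.le, glue_left qy hlt.le]
      simp only [dglue, if_pos hlt]; ring
    · rw [glue_right (not_lt.1 hlt), glue_right (not_lt.1 hlt)]
      simp only [dglue, if_neg hlt]; ring
  refine ⟨_, _, _, _, _, hc, ?_, ?_, ?_⟩
  · rw [glue_left qx (by norm_num), glue_left qy (by norm_num), glue_left qt (by norm_num)]
    simpa using h0
  · rw [glue_right (by norm_num), glue_right (by norm_num), glue_right (by norm_num)]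
    norm_num
    simpa using h1'
  · have hi := hc.sp_int
    have i1 : IntervalIntegrable (sp (dglue a a') (dglue b b')) volume 0 (1/2) := hi.mono_set (by
      rw [uIcc_of_le (by norm_num), uIcc_of_le zero_le_one]; exact Icc_subset_Icc le_rfl (by norm_num))
    have i2 : IntervalIntegrable (sp (dglue a a') (dglue b b')) volume (1/2) 1 := hi.mono_set (by
      rw [uIcc_of_le (by norm_num), uIcc_of_le zero_le_one]; exact Icc_subset_Icc (by norm_num) le_rfl)
    rw [← intervalIntegral.integral_add_adjacent_intervals i1 i2, hL, hL']
    have s2 : ∀ p q : ℝ, Real.sqrt ((2 * p) ^ 2 + (2 * q) ^ 2) = 2 * Real.sqrt (p ^ 2 + q ^ 2) := by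
      intro p q
      have : (2 * p) ^ 2 + (2 * q) ^ 2 = 2 ^ 2 * (p ^ 2 + q ^ 2) := by ring
      rw [this, Real.sqrt_mul (by positivity), Real.sqrt_sq (by norm_num)]
    congr 1
    · have e1 : ∫ s in (0:ℝ)..(1/2), sp (dglue a a') (dglue b b') s
          = ∫ s in (0:ℝ)..(1/2), 2 * sp a b (2 * s) := by
        apply intervalIntegral.integral_congr_ae
        filter_upwards [ae_ne (1/2)] with s h3 hs
        rw [uIoc_of_le (by norm_num)] at hs
        have : s < 1 / 2 := lt_of_le_of_ne hs.2 h3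
        simp only [sp, dglue, if_pos this, s2]
      rw [e1, intervalIntegral.integral_const_mul, intervalIntegral.mul_integral_comp_mul_left]
      norm_num
    · have e1 : ∫ s in (1/2:ℝ)..1, sp (dglue a a') (dglue b b') s
          = ∫ s in (1/2:ℝ)..1, 2 * sp a' b' (2 * s - 1) := by
        apply intervalIntegral.integral_congr_ae
        refine Filter.Eventually.of_forall fun s hs => ?_
        rw [uIoc_of_le (by norm_num)] at hs
        simp only [sp, dglue, if_neg (not_lt.2 hs.1.le), s2]
      rw [e1, intervalIntegral.integral_const_mul, intervalIntegral.mul_integral_comp_mul_sub]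
      norm_num

/-! ### Part 3: basic properties of the distance -/

lemma Hmul_HO (g : H) : Hmul g HO = g := by
  obtain ⟨a, b, c⟩ := g; simp [Hmul, HO]

lemma IsLen.mul {g h : H} {L M : ℝ} (hg : IsLen HO g L) (hh : IsLen HO h M) :
    IsLen HO (Hmul g h) (L + M) := by
  have := hh.trans_left g
  rw [Hmul_HO] at this
  exact hg.concat this

lemma Hmul_inv_cancel (g h : H) : Hmul g (Hmul (Hinv g) h) = h := by
  obtain ⟨a, b, c⟩ := g; obtain ⟨x, y, t⟩ := h
  simp only [Hmul, Hinv, Prod.mk.injEq]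
  refine ⟨by ring, by ring, by ring⟩

lemma Hinv_mul_cancel (g h : H) : Hmul (Hinv g) (Hmul g h) = h := by
  obtain ⟨a, b, c⟩ := g; obtain ⟨x, y, t⟩ := h
  simp only [Hmul, Hinv, Prod.mk.injEq]
  refine ⟨by ring, by ring, by ring⟩

def rr (x y : ℝ) : ℝ := Real.sqrt (x ^ 2 + y ^ 2)

lemma isLen_vert (t : ℝ) : IsLen HO (0, 0, t) (2 * Real.sqrt |t|) := by
  obtain ⟨b, hb, hab⟩ : ∃ b : ℝ, |b| = Real.sqrt |t| / 2 ∧ -4 * (Real.sqrt |t| / 2) * b = t := by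
    have h := Real.mul_self_sqrt (abs_nonneg t)
    rcases le_total 0 t with ht | ht
    · refine ⟨-(Real.sqrt |t| / 2), by rw [abs_neg, abs_of_nonneg (by positivity)], ?_⟩
      rw [abs_of_nonneg ht] at *; nlinarith
    · refine ⟨(Real.sqrt |t| / 2), by rw [abs_of_nonneg (by positivity)], ?_⟩
      rw [abs_of_nonpos ht] at *; nlinarith
  set a := Real.sqrt |t| / 2 with ha
  have ha0 : 0 ≤ a := by positivity
  have h1 := (((IsLen.seg a 0).mul (IsLen.seg 0 b)).mul (IsLen.seg (-a) 0)).mul (IsLen.seg 0 (-b))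
  have e0 : Real.sqrt (a ^ 2 + 0 ^ 2) = a := by
    rw [show a ^ 2 + 0 ^ 2 = a ^ 2 by ring, Real.sqrt_sq ha0]
  have e1 : Real.sqrt (0 ^ 2 + b ^ 2) = a := by
    rw [show 0 ^ 2 + b ^ 2 = b ^ 2 by ring, Real.sqrt_sq_eq_abs, hb]
  have e2 : Real.sqrt ((-a) ^ 2 + 0 ^ 2) = a := by
    rw [show (-a) ^ 2 + 0 ^ 2 = a ^ 2 by ring, Real.sqrt_sq ha0]
  have e3 : Real.sqrt (0 ^ 2 + (-b) ^ 2) = a := by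
    rw [show 0 ^ 2 + (-b) ^ 2 = b ^ 2 by ring, Real.sqrt_sq_eq_abs, hb]
  rw [e0, e1, e2, e3] at h1
  convert h1 using 1
  · simp only [Hmul, Prod.mk.injEq]
    refine ⟨by ring, by ring, by linarith⟩
  · rw [ha]; ring

lemma isLen_pt (x y t : ℝ) : IsLen HO (x, y, t) (2 * Real.sqrt |t| + rr x y) := by
  show IsLen HO (x, y, t) (2 * Real.sqrt |t| + Real.sqrt (x ^ 2 + y ^ 2))
  have := (isLen_vert t).mul (IsLen.seg x y)
  convert this using 1
  simp only [Hmul, Prod.mk.injEq]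
  refine ⟨by ring, by ring, by ring⟩

lemma exists_isLen (P Q : H) : ∃ L, IsLen P Q L := by
  have := (isLen_pt (Hmul (Hinv P) Q).1 (Hmul (Hinv P) Q).2.1 (Hmul (Hinv P) Q).2.2).trans_left P
  rw [Hmul_HO, show ((Hmul (Hinv P) Q).1, (Hmul (Hinv P) Q).2.1, (Hmul (Hinv P) Q).2.2)
    = Hmul (Hinv P) Q from rfl, Hmul_inv_cancel] at this
  exact ⟨_, this⟩

lemma exists_lt_of_dH {P Q : H} {L : ℝ} (h : dH P Q < L) : ∃ L', dH P Q ≤ L' ∧ L' < L ∧ IsLen P Q L' := by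
  rw [dH_eq_sInf] at h
  obtain ⟨L', h1, h2⟩ := exists_lt_of_csInf_lt (exists_isLen P Q) h
  exact ⟨L', IsLen.dH_le h1, h2, h1⟩

lemma dH_le_of_forall {P Q : H} {c : ℝ} (h : ∀ L, IsLen P Q L → c ≤ L) : c ≤ dH P Q := by
  rw [dH_eq_sInf]
  exact le_csInf (exists_isLen P Q) h

lemma dH_triangle (P Q R : H) : dH P R ≤ dH P Q + dH Q R := by
  have h1 : ∀ L, IsLen P Q L → dH P R - dH Q R ≤ L := by
    intro L hL
    have h2 : ∀ M, IsLen Q R M → dH P R - L ≤ M := by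
      intro M hM
      have := (hL.concat hM).dH_le
      linarith
    linarith [dH_le_of_forall h2]
  linarith [dH_le_of_forall h1]

lemma dH_left_le (g P Q : H) : dH (Hmul g P) (Hmul g Q) ≤ dH P Q :=
  dH_le_of_forall fun _ hL => (hL.trans_left g).dH_le

lemma dH_left (g P Q : H) : dH (Hmul g P) (Hmul g Q) = dH P Q := by
  refine le_antisymm (dH_left_le g P Q) ?_
  have := dH_left_le (Hinv g) (Hmul g P) (Hmul g Q)
  rwa [Hinv_mul_cancel, Hinv_mul_cancel] at this

lemma dH_sim_le (p q σ : ℝ) (hσ : σ ^ 2 = 1) (hpq : 0 < p ^ 2 + q ^ 2) (P Q : H) :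
    dH (Sim p q σ P) (Sim p q σ Q) ≤ rr p q * dH P Q := by
  have h0 : 0 < rr p q := Real.sqrt_pos.2 hpq
  rw [← div_le_iff₀' h0]
  refine dH_le_of_forall fun L hL => ?_
  rw [div_le_iff₀' h0]
  exact (hL.sim p q σ hσ).dH_le

lemma sim_inv (p q σ : ℝ) (hσ : σ ^ 2 = 1) (hpq : 0 < p ^ 2 + q ^ 2) (P : H) :
    Sim (p / (p ^ 2 + q ^ 2)) (-σ * q / (p ^ 2 + q ^ 2)) σ (Sim p q σ P) = P := by
  obtain ⟨x, y, t⟩ := P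
  have h1 := hpq.ne'
  simp only [Sim, Prod.mk.injEq]
  refine ⟨?_, ?_, ?_⟩
  · field_simp
    linear_combination (q ^ 2 * x + σ * p * q * y) * hσ
  · field_simp
    linear_combination (p ^ 2 * y + q ^ 2 * y) * hσ
  · field_simp
    linear_combination (t * p ^ 2 + t * q ^ 2 + t * q ^ 2 * (σ ^ 2)) * hσ

lemma rr_nonneg (x y : ℝ) : 0 ≤ rr x y := Real.sqrt_nonneg _

lemma rr_sq (x y : ℝ) : rr x y ^ 2 = x ^ 2 + y ^ 2 := Real.sq_sqrt (by positivity)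

lemma dH_sim (p q σ : ℝ) (hσ : σ ^ 2 = 1) (hpq : 0 < p ^ 2 + q ^ 2) (P Q : H) :
    dH (Sim p q σ P) (Sim p q σ Q) = rr p q * dH P Q := by
  refine le_antisymm (dH_sim_le p q σ hσ hpq P Q) ?_
  have e : (p / (p ^ 2 + q ^ 2)) ^ 2 + (-σ * q / (p ^ 2 + q ^ 2)) ^ 2 = 1 / (p ^ 2 + q ^ 2) := by
    have h1 := hpq.ne'
    field_simp
    linear_combination q ^ 2 * hσ
  have := dH_sim_le (p / (p ^ 2 + q ^ 2)) (-σ * q / (p ^ 2 + q ^ 2)) σ hσ (by rw [e]; positivity)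
    (Sim p q σ P) (Sim p q σ Q)
  rw [sim_inv p q σ hσ hpq, sim_inv p q σ hσ hpq] at this
  have e2 : rr (p / (p ^ 2 + q ^ 2)) (-σ * q / (p ^ 2 + q ^ 2)) = 1 / rr p q := by
    unfold rr
    rw [e, Real.sqrt_div zero_le_one, Real.sqrt_one]
  rw [e2] at this
  have h0 : 0 < rr p q := Real.sqrt_pos.2 hpq
  rw [one_div, ← div_eq_inv_mul, le_div_iff₀ h0] at this
  linarith

def nH (x y t : ℝ) : ℝ := dH HO (x, y, t)

lemma dH_eq (P Q : H) : dH P Q = nH (Q.1 - P.1) (Q.2.1 - P.2.1)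
    (Q.2.2 - P.2.2 - 2 * (Q.1 * P.2.1 - P.1 * Q.2.1)) := by
  have := dH_left P HO (Hmul (Hinv P) Q)
  rw [Hmul_HO, Hmul_inv_cancel] at this
  rw [this, nH]
  congr 1
  simp only [Hmul, Hinv, Prod.mk.injEq]
  refine ⟨by ring, by ring, by ring⟩

lemma nH_nonneg (x y t : ℝ) : 0 ≤ nH x y t := dH_nonneg _ _

lemma nH_le (x y t : ℝ) : nH x y t ≤ rr x y + 2 * Real.sqrt |t| := by
  have := (isLen_pt x y t).dH_le
  unfold nH; linarith

lemma nH_seg (x y : ℝ) : nH x y 0 ≤ rr x y := (IsLen.seg x y).dH_le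

lemma nH_mul (x y t x' y' t' : ℝ) :
    nH (x + x') (y + y') (t + t' + 2 * (x' * y - x * y')) ≤ nH x y t + nH x' y' t' := by
  have h1 := dH_triangle HO (x, y, t) (Hmul (x, y, t) (x', y', t'))
  have h2 := dH_left (x, y, t) HO (x', y', t')
  rw [Hmul_HO] at h2
  rw [h2] at h1
  exact h1

lemma nH_mul' {x y t x' y' t' X Y T : ℝ} (h1 : X = x + x') (h2 : Y = y + y')
    (h3 : T = t + t' + 2 * (x' * y - x * y')) : nH X Y T ≤ nH x y t + nH x' y' t' := by
  rw [h1, h2, h3]; exact nH_mul _ _ _ _ _ _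

lemma Sim_HO (p q σ : ℝ) : Sim p q σ HO = HO := by simp [Sim, HO]

/-- rotate to the positive real axis -/
lemma nH_rot (x y t : ℝ) : nH x y t = nH (rr x y) 0 t := by
  by_cases h : x ^ 2 + y ^ 2 = 0
  · have hx : x = 0 := by nlinarith [sq_nonneg x, sq_nonneg y]
    have hy : y = 0 := by nlinarith [sq_nonneg x, sq_nonneg y]
    simp [rr, hx, hy]
  · have h0 : 0 < x ^ 2 + y ^ 2 := lt_of_le_of_ne (by positivity) (Ne.symm h)
    have hr : 0 < rr x y := Real.sqrt_pos.2 h0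
    have hs := rr_sq x y
    have e : (x / rr x y) ^ 2 + (-y / rr x y) ^ 2 = 1 := by
      field_simp; linarith
    have e2 : rr (x / rr x y) (-y / rr x y) = 1 := by
      show Real.sqrt _ = 1
      rw [e, Real.sqrt_one]
    have := dH_sim (x / rr x y) (-y / rr x y) 1 (by norm_num) (by rw [e]; norm_num) HO (x, y, t)
    rw [Sim_HO, e2, one_mul] at this
    unfold nH
    rw [← this]
    congr 1
    simp only [Sim, Prod.mk.injEq]
    refine ⟨?_, ?_, ?_⟩
    · field_simp; linarith
    · field_simp; ring
    · rw [e]; ring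

lemma nH_neg_t (x y t : ℝ) : nH x y (-t) = nH x y t := by
  rw [nH_rot x y (-t), nH_rot x y t]
  have := dH_sim 1 0 (-1) (by norm_num) (by norm_num) HO (rr x y, 0, t)
  have e : rr 1 0 = 1 := by simp [rr]
  rw [Sim_HO, e, one_mul] at this
  unfold nH
  rw [← this]
  congr 1
  simp only [Sim, Prod.mk.injEq]
  refine ⟨by ring, by ring, by ring⟩

lemma nH_neg (x y t : ℝ) : nH (-x) (-y) (-t) = nH x y t := by
  rw [nH_neg_t, nH_rot, nH_rot x y]
  congr 1
  unfold rr; congr 1; ring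

lemma dH_comm (P Q : H) : dH P Q = dH Q P := by
  rw [dH_eq P Q, dH_eq Q P, ← nH_neg]
  congr 1 <;> ring

/-! ### Part 4: fine estimates -/

lemma rr_cs (x y u v : ℝ) : x * u + y * v ≤ rr x y * rr u v := by
  have h : (x * u + y * v) ^ 2 ≤ (rr x y * rr u v) ^ 2 := by
    rw [mul_pow, rr_sq, rr_sq]; nlinarith [sq_nonneg (x * v - y * u)]
  exact (le_abs_self _).trans (abs_le_of_sq_le_sq h (mul_nonneg (rr_nonneg _ _) (rr_nonneg _ _)))

lemma rr_le_of {x y c : ℝ} (hc : 0 ≤ c) (h : x ^ 2 + y ^ 2 ≤ c ^ 2) : rr x y ≤ c :=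
  Real.sqrt_le_iff.2 ⟨hc, h⟩

lemma abs_le_rr_left (x y : ℝ) : |x| ≤ rr x y := by
  apply Real.abs_le_sqrt; nlinarith [sq_nonneg y]

lemma abs_le_rr_right (x y : ℝ) : |y| ≤ rr x y := by
  apply Real.abs_le_sqrt; nlinarith [sq_nonneg x]

lemma rr_add (x y u v : ℝ) : rr (x + u) (y + v) ≤ rr x y + rr u v := by
  have h1 := rr_nonneg x y
  have h2 := rr_nonneg u v
  apply rr_le_of (by positivity)
  nlinarith [rr_sq x y, rr_sq u v, rr_cs x y u v]

lemma rr_smul (c x y : ℝ) : rr (c * x) (c * y) = |c| * rr x y := by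
  unfold rr
  rw [show (c * x) ^ 2 + (c * y) ^ 2 = c ^ 2 * (x ^ 2 + y ^ 2) by ring, Real.sqrt_mul (sq_nonneg _),
    Real.sqrt_sq_eq_abs]

lemma rr_neg (x y : ℝ) : rr (-x) (-y) = rr x y := by
  unfold rr; congr 1; ring

lemma Icc_sub {r r' : ℝ} (hr : r ∈ Icc (0:ℝ) 1) (hr' : r' ∈ Icc (0:ℝ) 1) {g : ℝ → ℝ}
    (hg : IntervalIntegrable g volume 0 1) : IntervalIntegrable g volume r r' :=
  hg.mono_set (by rw [uIcc_of_le (zero_le_one (α := ℝ))]; exact uIcc_subset_Icc hr hr')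

lemma Cv.chord {x y t a b : ℝ → ℝ} (h : Cv x y t a b) {r r' : ℝ} (hr : r ∈ Icc (0:ℝ) 1)
    (hr' : r' ∈ Icc (0:ℝ) 1) (hrr : r ≤ r') :
    rr (x r' - x r) (y r' - y r) ≤ ∫ s in r..r', sp a b s := by
  set u := x r' - x r with hu
  set v := y r' - y r with hv
  obtain ⟨ix, ex⟩ := h.lx.ftc h.dx hr hr'
  obtain ⟨iy, ey⟩ := h.ly.ftc h.dy hr hr'
  have is := Icc_sub hr hr' h.sp_int
  have h1 : ∫ s in r..r', (u * a s + v * b s) ≤ ∫ s in r..r', rr u v * sp a b s := by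
    apply intervalIntegral.integral_mono_on hrr ((ix.const_mul u).add (iy.const_mul v))
      (is.const_mul _)
    intro s _
    exact rr_cs _ _ _ _
  rw [intervalIntegral.integral_add (ix.const_mul u) (iy.const_mul v),
    intervalIntegral.integral_const_mul, intervalIntegral.integral_const_mul,
    intervalIntegral.integral_const_mul, ex, ey, ← hu, ← hv] at h1
  have h2 : 0 ≤ ∫ s in r..r', sp a b s :=
    intervalIntegral.integral_nonneg hrr fun s _ => sp_nonneg _ _ _
  have h3 := rr_sq u v
  rcases (rr_nonneg u v).eq_or_lt with h0 | h0
  · rw [← h0]; exact h2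
  · nlinarith

lemma Cv.area {x y t a b : ℝ → ℝ} (h : Cv x y t a b) (hx : x 0 = 0) (hy : y 0 = 0) (ht : t 0 = 0)
    (hy1 : y 1 = 0) (hx1 : 0 ≤ x 1) {L : ℝ} (hL : L = ∫ s in (0:ℝ)..1, sp a b s) :
    x 1 ≤ L ∧ (t 1) ^ 2 ≤ 32 * L ^ 3 * (L - x 1) := by
  have h0m : (0:ℝ) ∈ Icc (0:ℝ) 1 := by simp
  have h1m : (1:ℝ) ∈ Icc (0:ℝ) 1 := by simp
  have hc := h.chord h0m h1m zero_le_one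
  rw [hx, hy, hy1, ← hL] at hc
  have hxL : x 1 ≤ L := by
    have := abs_le_rr_left (x 1 - 0) (0 - 0)
    have := le_abs_self (x 1 - 0)
    linarith
  refine ⟨hxL, ?_⟩
  have hL0 : 0 ≤ L := hx1.trans hxL
  set B := Real.sqrt (2 * L * (L - x 1)) with hB
  have hB2 : B ^ 2 = 2 * L * (L - x 1) := Real.sq_sqrt (by
    have : 0 ≤ L - x 1 := by linarith
    positivity)
  have hyB : ∀ s ∈ Icc (0:ℝ) 1, |y s| ≤ B := by
    intro s hs
    have c1 := h.chord h0m hs hs.1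
    have c2 := h.chord hs h1m hs.2
    have c3 := intervalIntegral.integral_add_adjacent_intervals (Icc_sub h0m hs h.sp_int)
      (Icc_sub hs h1m h.sp_int)
    rw [hx, hy, sub_zero, sub_zero] at c1
    have d1 := (le_abs_self _).trans (abs_le_rr_left (x 1 - x s) (y 1 - y s))
    have d2 := (le_abs_self _).trans (abs_le_rr_left (x s) (y s))
    have d3 := (neg_le_abs _).trans (abs_le_rr_left (x s) (y s))
    have d4 := rr_sq (x s) (y s)
    have d5 : rr (x s) (y s) ≤ L := by
      have := rr_nonneg (x 1 - x s) (y 1 - y s); linarith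
    apply Real.abs_le_sqrt
    have : y s ^ 2 = (rr (x s) (y s) - x s) * (rr (x s) (y s) + x s) := by nlinarith
    rw [this]
    have f1 : 0 ≤ rr (x s) (y s) - x s := by linarith
    have f2 : rr (x s) (y s) - x s ≤ L - x 1 := by linarith
    have f3 : rr (x s) (y s) + x s ≤ 2 * L := by linarith
    have f4 : 0 ≤ rr (x s) (y s) + x s := by linarith
    calc _ ≤ (L - x 1) * (2 * L) := mul_le_mul f2 f3 f4 (f1.trans f2)
      _ = _ := by ring
  have hlip : Lip (fun s => t s + 2 * (x s * y s)) := h.lt.add ((h.lx.mul h.ly).cmul 2)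
  have hder : ∀ᵐ s ∂volume, s ∈ Icc (0:ℝ) 1 →
      HasDerivAt (fun s => t s + 2 * (x s * y s)) (4 * y s * a s) s := by
    filter_upwards [h.dx, h.dy, h.dt] with s h1 h2 h3 hs
    refine ((h3 hs).add (((h1 hs).mul (h2 hs)).const_mul 2)).congr_deriv ?_
    ring
  obtain ⟨i1, e1⟩ := hlip.ftc hder h0m h1m
  simp only [hx, hy, ht, hy1, mul_zero, add_zero, sub_zero] at e1
  have hle : |t 1| ≤ 4 * B * L := by
    rw [← e1, hL, ← intervalIntegral.integral_const_mul]
    refine (intervalIntegral.abs_integral_le_integral_abs zero_le_one).trans ?_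
    apply intervalIntegral.integral_mono_on zero_le_one i1.abs (h.sp_int.const_mul _)
    intro s hs
    rw [abs_mul, abs_mul, abs_of_nonneg (by norm_num : (0:ℝ) ≤ 4)]
    have g1 := hyB s hs
    have g2 : |a s| ≤ sp a b s := abs_le_rr_left (a s) (b s)
    have : |y s| * |a s| ≤ B * sp a b s := mul_le_mul g1 g2 (abs_nonneg _) (Real.sqrt_nonneg _)
    nlinarith
  have : t 1 ^ 2 ≤ (4 * B * L) ^ 2 := by
    rw [← sq_abs]
    exact pow_le_pow_left₀ (abs_nonneg _) hle 2
  calc t 1 ^ 2 ≤ (4 * B * L) ^ 2 := this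
    _ = 16 * B ^ 2 * L ^ 2 := by ring
    _ = _ := by rw [hB2]; ring

lemma nH_lower_axis (c t : ℝ) (hc : 0 ≤ c) :
    c ≤ nH c 0 t ∧ t ^ 2 ≤ 32 * nH c 0 t ^ 3 * (nH c 0 t - c) := by
  have key : ∀ L, IsLen HO (c, 0, t) L → c ≤ L ∧ t ^ 2 ≤ 32 * L ^ 3 * (L - c) := by
    rintro L ⟨x, y, t', a, b, h, h0, h1, hL⟩
    simp only [HO, Prod.mk.injEq] at h0 h1
    have := h.area h0.1 h0.2.1 h0.2.2 h1.2.1 (by rw [h1.1]; exact hc) hL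
    rwa [h1.1, h1.2.2] at this
  have h1 : c ≤ nH c 0 t := dH_le_of_forall fun L hL => (key L hL).1
  refine ⟨h1, ?_⟩
  have hcont : Continuous (fun L : ℝ => 32 * L ^ 3 * (L - c)) := by fun_prop
  have ht := (hcont.tendsto (nH c 0 t)).mono_left (nhdsWithin_le_nhds (s := Ioi (nH c 0 t)))
  refine ge_of_tendsto ht ?_
  filter_upwards [self_mem_nhdsWithin] with L hL
  obtain ⟨L', e1, e2, e3⟩ := exists_lt_of_dH (show dH HO (c, 0, t) < L from hL)
  obtain ⟨k1, k2⟩ := key L' e3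
  have hL' : 0 ≤ L' := hc.trans k1
  refine k2.trans ?_
  have : L' ^ 3 ≤ L ^ 3 := pow_le_pow_left₀ hL' e2.le 3
  have g1 : 0 ≤ L' - c := by linarith
  have g2 : L' - c ≤ L - c := by linarith
  have g3 : (0:ℝ) ≤ 32 * L ^ 3 := by have : 0 ≤ L := hL'.trans e2.le; positivity
  exact mul_le_mul (by linarith) g2 g1 g3

lemma rr_le_nH (x y t : ℝ) : rr x y ≤ nH x y t := by
  rw [nH_rot]; exact (nH_lower_axis _ t (rr_nonneg x y)).1

lemma t_sq_le (x y t : ℝ) : t ^ 2 ≤ 32 * nH x y t ^ 3 * (nH x y t - rr x y) := by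
  rw [nH_rot]; exact (nH_lower_axis _ t (rr_nonneg x y)).2

lemma abs_t_le (x y t : ℝ) : |t| ≤ 6 * nH x y t ^ 2 := by
  have h := t_sq_le x y t
  have h0 := nH_nonneg x y t
  have h1 := rr_nonneg x y
  refine abs_le_of_sq_le_sq ?_ (by positivity)
  have : 32 * nH x y t ^ 3 * (nH x y t - rr x y) ≤ 32 * nH x y t ^ 3 * nH x y t := by
    apply mul_le_mul_of_nonneg_left (by linarith) (by positivity)
  nlinarith [pow_nonneg h0 4]

lemma nH_upper (x y t : ℝ) (hr : 0 < rr x y) : nH x y t ≤ rr x y + t ^ 2 / (2 * rr x y ^ 3) := by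
  rw [nH_rot]
  set c := rr x y
  have h1 := nH_mul' (X := c) (Y := 0) (T := t) (x := c / 2) (y := t / (2 * c)) (t := 0)
    (x' := c / 2) (y' := -(t / (2 * c))) (t' := 0) (by ring) (by ring) (by field_simp; ring)
  have e : ∀ h : ℝ, rr (c / 2) h ≤ c / 2 + h ^ 2 / c := by
    intro h
    apply rr_le_of (by positivity)
    have : (c / 2 + h ^ 2 / c) ^ 2 = c ^ 2 / 4 + h ^ 2 + (h ^ 2 / c) ^ 2 := by field_simp; ring
    rw [this]; nlinarith [sq_nonneg (h ^ 2 / c)]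
  have h2 := (nH_seg (c / 2) (t / (2 * c))).trans (e _)
  have h3 := (nH_seg (c / 2) (-(t / (2 * c)))).trans (e _)
  have : c / 2 + (t / (2 * c)) ^ 2 / c + (c / 2 + (-(t / (2 * c))) ^ 2 / c)
      = c + t ^ 2 / (2 * c ^ 3) := by field_simp; ring
  linarith

/-- First variation. -/
lemma variation (z1 z2 τ ℓ : ℝ) (hℓ : nH z1 z2 τ < ℓ) (hpos : 0 < nH z1 z2 τ) :
    ∃ L m1 m2 : ℝ, nH z1 z2 τ ≤ L ∧ L < ℓ ∧ |m1| ≤ L ∧ |m2| ≤ L ∧ ∀ v1 v2 : ℝ,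
      nH (z1 + v1) (z2 + v2) (τ - 2 * (v1 * (z2 - 2 * m2) - v2 * (z1 - 2 * m1)))
        ≤ L + (z1 * v1 + z2 * v2) / L + (v1 ^ 2 + v2 ^ 2) / (2 * L) := by
  obtain ⟨L, e1, e2, e3⟩ := exists_lt_of_dH hℓ
  have hL0 : 0 < L := lt_of_lt_of_le hpos e1
  obtain ⟨x, y, t, a, b, h, h0, h1, hL⟩ := e3
  simp only [HO, Prod.mk.injEq] at h0 h1
  obtain ⟨x0, y0, t0⟩ := h0
  obtain ⟨x1, y1, t1⟩ := h1
  have h0m : (0:ℝ) ∈ Icc (0:ℝ) 1 := by simp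
  have h1m : (1:ℝ) ∈ Icc (0:ℝ) 1 := by simp
  obtain ⟨B, hB0, hB⟩ := h.sp_bdd
  set ρ : ℝ → ℝ := fun s => sp a b s / L with hρ
  have iρ : IntervalIntegrable ρ volume 0 1 := h.sp_int.div_const L
  have hρ0 : ∀ s, 0 ≤ ρ s := fun s => div_nonneg (sp_nonneg _ _ _) hL0.le
  have hρ1 : ∫ s in (0:ℝ)..1, ρ s = 1 := by
    rw [hρ, intervalIntegral.integral_div, ← hL, div_self hL0.ne']
  have bρ : ∀ᵐ s ∂volume, s ∈ Icc (0:ℝ) 1 → |ρ s| ≤ B / L := by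
    filter_upwards [hB] with s hs hs'
    rw [hρ]; simp only [abs_div, abs_of_pos hL0]
    exact div_le_div_of_nonneg_right (hs hs') hL0.le
  have cont : ∀ f : ℝ → ℝ, Lip f → ContinuousOn f (uIcc 0 1) := by
    intro f hf
    obtain ⟨K, hK⟩ := hf.lipOn
    rw [uIcc_of_le zero_le_one]
    exact hK.continuousOn
  have mk : ∀ f : ℝ → ℝ, Lip f → (∀ s ∈ Icc (0:ℝ) 1, |f s| ≤ L) →
      ∃ M : ℝ → ℝ, Lip M ∧ M 0 = 0 ∧ |M 1| ≤ L ∧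
        ∀ᵐ s ∂volume, s ∈ Icc (0:ℝ) 1 → HasDerivAt M (f s * ρ s) s := by
    intro f hf hfL
    have i1 : IntervalIntegrable (fun s => f s * ρ s) volume 0 1 := iρ.continuousOn_mul (cont f hf)
    refine ⟨fun s => ∫ u in (0:ℝ)..s, f u * ρ u, Lip.integral (B := L * (B / L)) i1 ?_, by simp, ?_,
      hasDeriv_integral i1⟩
    · filter_upwards [bρ] with s hs hs'
      rw [abs_mul]
      exact mul_le_mul (hfL s hs') (hs hs') (abs_nonneg _) hL0.le
    · refine (intervalIntegral.abs_integral_le_integral_abs zero_le_one).trans ?_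
      have : ∫ s in (0:ℝ)..1, L * ρ s = L := by
        rw [intervalIntegral.integral_const_mul, hρ1, mul_one]
      refine le_trans ?_ this.le
      apply intervalIntegral.integral_mono_on zero_le_one i1.abs (iρ.const_mul _)
      intro s hs
      rw [abs_mul, abs_of_nonneg (hρ0 s)]
      exact mul_le_mul_of_nonneg_right (hfL s hs) (hρ0 s)
  have hrL : ∀ s ∈ Icc (0:ℝ) 1, rr (x s) (y s) ≤ L := by
    intro s hs
    have c1 := h.chord h0m hs hs.1
    have c3 := intervalIntegral.integral_add_adjacent_intervals (Icc_sub h0m hs h.sp_int)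
      (Icc_sub hs h1m h.sp_int)
    have c4 : 0 ≤ ∫ u in s..1, sp a b u :=
      intervalIntegral.integral_nonneg hs.2 fun s _ => sp_nonneg _ _ _
    rw [x0, y0, sub_zero, sub_zero] at c1
    linarith
  obtain ⟨M1, lM1, M10, bM1, dM1⟩ := mk x h.lx fun s hs => (abs_le_rr_left _ _).trans (hrL s hs)
  obtain ⟨M2, lM2, M20, bM2, dM2⟩ := mk y h.ly fun s hs => (abs_le_rr_right _ _).trans (hrL s hs)
  have lS : Lip (fun s => ∫ u in (0:ℝ)..s, ρ u) := Lip.integral iρ bρ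
  have dS := hasDeriv_integral iρ
  set S : ℝ → ℝ := fun s => ∫ u in (0:ℝ)..s, ρ u with hS
  have S0 : S 0 = 0 := by simp [hS]
  have S1 : S 1 = 1 := hρ1
  refine ⟨L, M1 1, M2 1, e1, e2, bM1, bM2, fun v1 v2 => ?_⟩
  have hcv : Cv (fun s => x s + v1 * S s) (fun s => y s + v2 * S s)
      (fun s => t s - 2 * (v1 * (S s * y s - 2 * M2 s) - v2 * (S s * x s - 2 * M1 s)))
      (fun s => a s + v1 * ρ s) (fun s => b s + v2 * ρ s) := by
    refine ⟨h.lx.add (lS.cmul v1), h.ly.add (lS.cmul v2), ?_, ?_, ?_, ?_⟩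
    · refine ((((h.lt.add ((lS.mul h.ly).cmul (-2 * v1))).add (lM2.cmul (4 * v1))).add
        ((lS.mul h.lx).cmul (2 * v2))).add (lM1.cmul (-4 * v2))).congr fun s => ?_
      ring
    · filter_upwards [h.dx, dS] with s h1 h2 hs
      exact (h1 hs).add ((h2 hs).const_mul v1)
    · filter_upwards [h.dy, dS] with s h1 h2 hs
      exact (h1 hs).add ((h2 hs).const_mul v2)
    · filter_upwards [h.dx, h.dy, h.dt, dS, dM1, dM2] with s h1 h2 h3 h4 h5 h6 hs
      refine ((h3 hs).sub ((((((h4 hs).mul (h2 hs)).sub ((h6 hs).const_mul 2)).const_mul v1).sub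
        ((((h4 hs).mul (h1 hs)).sub ((h5 hs).const_mul 2)).const_mul v2)).const_mul 2)).congr_deriv ?_
      ring
  have hlen : IsLen HO (z1 + v1, z2 + v2, τ - 2 * (v1 * (z2 - 2 * M2 1) - v2 * (z1 - 2 * M1 1)))
      (∫ s in (0:ℝ)..1, sp (fun s => a s + v1 * ρ s) (fun s => b s + v2 * ρ s) s) := by
    refine ⟨_, _, _, _, _, hcv, ?_, ?_, rfl⟩
    · simp only [x0, y0, t0, S0, M10, M20, HO]; simp
    · simp only [x1, y1, t1, S1]; simp
  refine hlen.dH_le.trans ?_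
  obtain ⟨ix, ex⟩ := h.lx.ftc h.dx h0m h1m
  obtain ⟨iy, ey⟩ := h.ly.ftc h.dy h0m h1m
  rw [x0, x1, sub_zero] at ex
  rw [y0, y1, sub_zero] at ey
  have i3 : IntervalIntegrable (fun s => (v1 / L * a s + v2 / L * b s)) volume 0 1 :=
    (ix.const_mul (v1 / L)).add (iy.const_mul (v2 / L))
  have i4 : IntervalIntegrable (fun s => (1 + (v1 ^ 2 + v2 ^ 2) / (2 * L ^ 2)) * sp a b s) volume 0 1 :=
    h.sp_int.const_mul _
  have hval : ∫ s in (0:ℝ)..1, ((v1 / L * a s + v2 / L * b s) +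
      (1 + (v1 ^ 2 + v2 ^ 2) / (2 * L ^ 2)) * sp a b s)
      = L + (z1 * v1 + z2 * v2) / L + (v1 ^ 2 + v2 ^ 2) / (2 * L) := by
    rw [intervalIntegral.integral_add i3 i4,
      intervalIntegral.integral_add (ix.const_mul (v1 / L)) (iy.const_mul (v2 / L)),
      intervalIntegral.integral_const_mul, intervalIntegral.integral_const_mul,
      intervalIntegral.integral_const_mul, ex, ey, ← hL]
    field_simp; ring
  rw [← hval]
  apply intervalIntegral.integral_mono_on zero_le_one hcv.sp_int (i3.add i4)
  intro s _
  have hw0 := sp_nonneg a b s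
  have hw2 : sp a b s ^ 2 = a s ^ 2 + b s ^ 2 := rr_sq (a s) (b s)
  have hcs : -(v1 * a s + v2 * b s) ≤ rr v1 v2 * sp a b s := by
    have := rr_cs (-v1) (-v2) (a s) (b s)
    rw [rr_neg] at this
    have e : rr (a s) (b s) = sp a b s := rfl
    rw [e] at this; linarith
  have hv2 := rr_sq v1 v2
  show Real.sqrt ((a s + v1 * ρ s) ^ 2 + (b s + v2 * ρ s) ^ 2) ≤ _
  set w := sp a b s with hw
  have hρs : ρ s = w / L := rfl
  rw [hρs]
  apply Real.sqrt_le_iff.2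
  have eq1 : (v1 / L * a s + v2 / L * b s) + (1 + (v1 ^ 2 + v2 ^ 2) / (2 * L ^ 2)) * w
      = w + (v1 * a s + v2 * b s) / L + (v1 ^ 2 + v2 ^ 2) * w / (2 * L ^ 2) := by field_simp; ring
  rw [eq1]
  constructor
  · rw [← hv2]
    have : w + (v1 * a s + v2 * b s) / L + rr v1 v2 ^ 2 * w / (2 * L ^ 2) =
      ((v1 * a s + v2 * b s + rr v1 v2 * w) * (2 * L) + w * ((L - rr v1 v2) ^ 2 + L ^ 2)) / (2 * L ^ 2) := by
      field_simp; ring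
    rw [this]
    apply div_nonneg _ (by positivity)
    have : 0 ≤ v1 * a s + v2 * b s + rr v1 v2 * w := by linarith
    positivity
  · have : (a s + v1 * (w / L)) ^ 2 + (b s + v2 * (w / L)) ^ 2 =
        (a s ^ 2 + b s ^ 2) + 2 * w * ((v1 * a s + v2 * b s) / L) + (v1 ^ 2 + v2 ^ 2) * w ^ 2 / L ^ 2 := by
      field_simp; ring
    rw [this, ← hw2]
    have e5 : (v1 ^ 2 + v2 ^ 2) * w ^ 2 / L ^ 2 = 2 * w * ((v1 ^ 2 + v2 ^ 2) * w / (2 * L ^ 2)) := by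
      field_simp
    rw [e5]
    nlinarith [sq_nonneg ((v1 * a s + v2 * b s) / L + (v1 ^ 2 + v2 ^ 2) * w / (2 * L ^ 2))]

/-! ### Part 5: first variation along chains -/

def tt (P Q : H) : ℝ := Q.2.2 - P.2.2 - 2 * (Q.1 * P.2.1 - P.1 * Q.2.1)
def dx (P Q : H) : ℝ := Q.1 - P.1
def dy (P Q : H) : ℝ := Q.2.1 - P.2.1

lemma dH_eq' (P Q : H) : dH P Q = nH (dx P Q) (dy P Q) (tt P Q) := dH_eq P Q

lemma dH_self (P : H) : dH P P = 0 := by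
  apply le_antisymm _ (dH_nonneg _ _)
  rw [dH_eq]
  have := nH_le 0 0 0
  simpa [rr] using this

def Up (P : H) (c : ℝ) : H := (P.1, P.2.1, P.2.2 + c)

lemma dH_Up (P Q : H) (c : ℝ) : dH (Up P c) (Up Q c) = dH P Q := by
  rw [dH_eq, dH_eq P Q]; simp [Up]

lemma rr_dx_le (P Q : H) : rr (dx P Q) (dy P Q) ≤ dH P Q := by
  rw [dH_eq']; exact rr_le_nH _ _ _

lemma abs_tt_le (P Q : H) : |tt P Q| ≤ 6 * dH P Q ^ 2 := by
  rw [dH_eq']; exact abs_t_le _ _ _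

/-- perturbation property of a unit step -/
def Pert (ε : ℝ) (P P' : H) (m1 m2 : ℝ) : Prop :=
  ∀ w1 w2 : ℝ, w1 ^ 2 + w2 ^ 2 ≤ 1 →
    nH (dx P P' + w1) (dy P P' + w2)
      (tt P P' - 2 * (w1 * (dy P P' - 2 * m2) - w2 * (dx P P' - 2 * m1)))
      ≤ 1 + 4 * ε + (dx P P' * w1 + dy P P' * w2) + (w1 ^ 2 + w2 ^ 2)

lemma exists_pert {ε : ℝ} (hε : 0 < ε) (hε' : ε ≤ 1 / 4) {P P' : H} (h1 : 1 - ε ≤ dH P P')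
    (h2 : dH P P' ≤ 1 + ε) : ∃ m1 m2, |m1| ≤ 2 ∧ |m2| ≤ 2 ∧ Pert ε P P' m1 m2 := by
  rw [dH_eq'] at h1 h2
  obtain ⟨L, m1, m2, a1, a2, a3, a4, h⟩ := variation (dx P P') (dy P P') (tt P P') (1 + 2 * ε)
    (by linarith) (by linarith)
  refine ⟨m1, m2, by linarith, by linarith, fun w1 w2 hw => (h w1 w2).trans ?_⟩
  have hr := rr_le_nH (dx P P') (dy P P') (tt P P')
  have hL : 3 / 4 ≤ L := by linarith
  have hL0 : 0 < L := by linarith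
  have hw1 : rr w1 w2 ≤ 1 := rr_le_of zero_le_one (by linarith)
  have c1 := rr_cs (dx P P') (dy P P') w1 w2
  have c2 := rr_cs (dx P P') (dy P P') (-w1) (-w2)
  rw [rr_neg] at c2
  have c3 : rr (dx P P') (dy P P') * rr w1 w2 ≤ L := by
    have := mul_le_mul (hr.trans a1) hw1 (rr_nonneg _ _) hL0.le
    linarith
  set I := dx P P' * w1 + dy P P' * w2 with hI
  have i1 : I ≤ L := c1.trans c3
  have i2 : -L ≤ I := by linarith
  have e1 : I / L ≤ I + 2 * ε := by
    rw [div_le_iff₀ hL0]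
    nlinarith
  have e2 : (w1 ^ 2 + w2 ^ 2) / (2 * L) ≤ w1 ^ 2 + w2 ^ 2 := by
    apply div_le_self (by positivity) (by linarith)
  linarith

lemma trap {ε : ℝ} {P P' Q Q' : H} {m1 m2 n1 n2 : ℝ} (h1 : Pert ε P P' m1 m2)
    (h2 : Pert ε Q Q' n1 n2) (w1 w2 : ℝ) (hw : w1 ^ 2 + w2 ^ 2 ≤ 1) :
    dH P (Up Q' (-4 * (w1 * (dy P Q + n2 - m2) - w2 * (dx P Q + n1 - m1)))) ≤
      2 + 8 * ε + dH P' Q + ((dx P P' - dx Q Q') * w1 + (dy P P' - dy Q Q') * w2)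
        + 2 * (w1 ^ 2 + w2 ^ 2) := by
  have a1 := h1 w1 w2 hw
  have a2 := h2 (-w1) (-w2) (by linarith [neg_sq w1, neg_sq w2])
  rw [dH_eq' P' Q, dH_eq']
  have b1 := nH_mul (dx P P' + w1) (dy P P' + w2) 
      (tt P P' - 2 * (w1 * (dy P P' - 2 * m2) - w2 * (dx P P' - 2 * m1))) (dx P' Q) (dy P' Q) (tt P' Q)
  have b2 := nH_mul' (X := dx P (Up Q' (-4 * (w1 * (dy P Q + n2 - m2) - w2 * (dx P Q + n1 - m1)))))
    (Y := dy P (Up Q' (-4 * (w1 * (dy P Q + n2 - m2) - w2 * (dx P Q + n1 - m1)))))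
    (T := tt P (Up Q' (-4 * (w1 * (dy P Q + n2 - m2) - w2 * (dx P Q + n1 - m1)))))
    (x := dx P P' + w1 + dx P' Q) (y := dy P P' + w2 + dy P' Q)
    (t := (tt P P' - 2 * (w1 * (dy P P' - 2 * m2) - w2 * (dx P P' - 2 * m1))) + tt P' Q
      + 2 * (dx P' Q * (dy P P' + w2) - (dx P P' + w1) * dy P' Q))
    (x' := dx Q Q' + -w1) (y' := dy Q Q' + -w2)
    (t' := tt Q Q' - 2 * (-w1 * (dy Q Q' - 2 * n2) - -w2 * (dx Q Q' - 2 * n1)))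
    (by simp only [dx, Up]; ring) (by simp only [dy, Up]; ring) (by simp only [dx, dy, tt, Up]; ring)
  nlinarith

def Qseq (ε : ℝ) (q : ℕ → H) : Prop := ∀ i j : ℕ, i ≤ j →
  (1 - ε) * ((j:ℝ) - i) ≤ dH (q i) (q j) ∧ dH (q i) (q j) ≤ (1 + ε) * ((j:ℝ) - i)

lemma Qseq.step {ε : ℝ} {q : ℕ → H} (h : Qseq ε q) (i : ℕ) :
    1 - ε ≤ dH (q i) (q (i+1)) ∧ dH (q i) (q (i+1)) ≤ 1 + ε := by
  have := h i (i+1) (by omega)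
  push_cast at this
  constructor <;> linarith [this.1, this.2]

lemma omega_le {a b c d A B : ℝ} (h1 : rr a b ≤ A) (h2 : rr c d ≤ B) : |a * d - b * c| ≤ A * B := by
  have e1 := rr_cs a b d (-c)
  have e2 := rr_cs a b (-d) c
  have : rr d (-c) = rr c d := by unfold rr; congr 1; ring
  rw [this] at e1
  have : rr (-d) c = rr c d := by unfold rr; congr 1; ring
  rw [this] at e2
  have := mul_le_mul h1 h2 (rr_nonneg _ _) ((rr_nonneg _ _).trans h1)
  rw [abs_le]; constructor <;> linarith

lemma tt_sum {ε : ℝ} {q : ℕ → H} (h : Qseq ε q) (hε : 0 < ε) (hε' : ε ≤ 1 / 4) (s : ℕ) (B : ℝ) (m : ℕ)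
    (hB : ∀ i < m, |dx (q s) (q (s+i)) * dy (q (s+i)) (q (s+i+1))
      - dy (q s) (q (s+i)) * dx (q (s+i)) (q (s+i+1))| ≤ B) :
    |tt (q s) (q (s+m))| ≤ m * (24 + 2 * B) := by
  induction m with
  | zero => simp [tt]
  | succ m ih =>
    have i1 := ih fun i hi => hB i (by omega)
    have i2 := hB m (by omega)
    have i3 := abs_tt_le (q (s+m)) (q (s+m+1))
    have i4 := h.step (s+m)
    have i5 : dH (q (s+m)) (q (s+m+1)) ^ 2 ≤ 4 := by nlinarith [dH_nonneg (q (s+m)) (q (s+m+1))]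
    have e : tt (q s) (q (s+(m+1))) = tt (q s) (q (s+m)) + tt (q (s+m)) (q (s+m+1))
      - 2 * (dx (q s) (q (s+m)) * dy (q (s+m)) (q (s+m+1))
      - dy (q s) (q (s+m)) * dx (q (s+m)) (q (s+m+1))) := by
      rw [← add_assoc]; simp only [tt, dx, dy]; ring
    rw [e]
    push_cast
    rw [abs_le] at *
    constructor <;> linarith [i1.1, i1.2, i2.1, i2.2, i3.1, i3.2]

lemma long_chord {ε : ℝ} {q : ℕ → H} (h : Qseq ε q) (hε : 0 < ε) (hε' : ε ≤ 1 / 4) (s N : ℕ)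
    (hN : 10000 ≤ N) : ∃ k, s < k ∧ k ≤ s + N ∧ (N:ℝ) / 100 ≤ rr (dx (q s) (q k)) (dy (q s) (q k)) := by
  by_contra! hc
  have hNR : (10000:ℝ) ≤ N := by exact_mod_cast hN
  have hc' : ∀ i ≤ N, rr (dx (q s) (q (s+i))) (dy (q s) (q (s+i))) ≤ (N:ℝ) / 100 := by
    intro i hi
    rcases Nat.eq_zero_or_pos i with h0 | h0
    · subst h0; simp [dx, dy, rr]; positivity
    · exact (hc _ (by omega) (by omega)).le
  have h1 := tt_sum h hε hε' s ((N:ℝ) / 100 * 2) N (by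
    intro i hi
    apply omega_le (hc' i hi.le)
    have := rr_dx_le (q (s+i)) (q (s+i+1))
    have := (h.step (s+i)).2
    linarith)
  have h2 := nH_le (dx (q s) (q (s+N))) (dy (q s) (q (s+N))) (tt (q s) (q (s+N)))
  rw [← dH_eq'] at h2
  have h3 := (h s (s+N) (by omega)).1
  push_cast at h3
  have h4 : Real.sqrt |tt (q s) (q (s+N))| ≤ 0.23 * N := by
    apply Real.sqrt_le_iff.2
    constructor
    · positivity
    · nlinarith
  have h5 := hc' N le_rfl
  nlinarith

/-! ### Part 6: second differences are small -/

set_option maxHeartbeats 1000000 in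
lemma second_diff_v {ε : ℝ} {q : ℕ → H} (h : Qseq ε q) (hε : 0 < ε) (hε' : ε ≤ 1 / 4) (n N : ℕ)
    (hN : 10000 ≤ N) (hnN : n + 1 ≤ N) (hNε : (N:ℝ) ^ 3 * ε ≤ 1) (j : ℕ) (hj : j + 1 ≤ n)
    (v1 v2 : ℝ) (hv : rr v1 v2 = 1 / N) :
    (dx (q (j+1)) (q (j+2)) - dx (q j) (q (j+1))) * v1
      + (dy (q (j+1)) (q (j+2)) - dy (q j) (q (j+1))) * v2 ≤ 7000 / N ^ 2 := by
  have hNR : (10000:ℝ) ≤ N := by exact_mod_cast hN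
  have hN0 : (0:ℝ) < N := by linarith
  obtain ⟨k, k1, k2, k3⟩ := long_chord h hε hε' (n+1) N hN
  obtain ⟨a1, a2, ha1, ha2, pa⟩ := exists_pert hε hε' (h.step j).1 (h.step j).2
  obtain ⟨b1, b2, hb1, hb2, pb⟩ := exists_pert hε hε' (h.step (j+1)).1 (h.step (j+1)).2
  obtain ⟨c1, c2, hc1, hc2, pc⟩ := exists_pert hε hε' (h.step (n+1)).1 (h.step (n+1)).2
  obtain ⟨d1, d2, hd1, hd2, pd⟩ := exists_pert hε hε' (h.step k).1 (h.step k).2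
  -- the two displacement vectors
  set E1 := dx (q j) (q (j+1)) + b1 - a1 with hE1
  set E2 := dy (q j) (q (j+1)) + b2 - a2 with hE2
  set D1 := dx (q (n+1)) (q k) + d1 - c1 with hD1
  set D2 := dy (q (n+1)) (q k) + d2 - c2 with hD2
  have s1 : ∀ i, rr (dx (q i) (q (i+1))) (dy (q i) (q (i+1))) ≤ 5 / 4 := fun i => by
    have := rr_dx_le (q i) (q (i+1))
    have := (h.step i).2
    linarith
  have r4 : ∀ x y : ℝ, |x| ≤ 4 → |y| ≤ 4 → rr x y ≤ 6 := by
    intro x y hx hy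
    apply rr_le_of (by norm_num)
    rw [← sq_abs x, ← sq_abs y]
    nlinarith [abs_nonneg x, abs_nonneg y]
  have sub4 : ∀ x y : ℝ, |x| ≤ 2 → |y| ≤ 2 → |x - y| ≤ 4 := by
    intro x y hx hy
    rw [abs_le] at *; constructor <;> linarith [hx.1, hx.2, hy.1, hy.2]
  have hE : rr E1 E2 ≤ 8 := by
    have e1 := rr_add (dx (q j) (q (j+1))) (dy (q j) (q (j+1))) (b1 - a1) (b2 - a2)
    have e2 := r4 _ _ (sub4 _ _ hb1 ha1) (sub4 _ _ hb2 ha2)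
    have e3 := s1 j
    rw [hE1, hE2, add_sub_assoc, add_sub_assoc]
    linarith
  have hD : (N:ℝ) / 200 ≤ rr D1 D2 := by
    have e1 := rr_add D1 D2 (c1 - d1) (c2 - d2)
    have e2 := r4 _ _ (sub4 _ _ hc1 hd1) (sub4 _ _ hc2 hd2)
    have e3 : D1 + (c1 - d1) = dx (q (n+1)) (q k) := by rw [hD1]; ring
    have e4 : D2 + (c2 - d2) = dy (q (n+1)) (q k) := by rw [hD2]; ring
    rw [e3, e4] at e1
    linarith
  have hDp : 0 < rr D1 D2 := lt_of_lt_of_le (by positivity) hD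
  set β := -(v1 * E2 - v2 * E1) with hβ
  have hβ1 : |β| ≤ 1 / N * 8 := by
    rw [hβ, abs_neg]; exact omega_le hv.le hE
  set w1 := β / rr D1 D2 ^ 2 * D2 with hw1
  set w2 := β / rr D1 D2 ^ 2 * (-D1) with hw2
  have hw : rr w1 w2 ≤ 1600 / N ^ 2 := by
    rw [hw1, hw2, rr_smul]
    have : rr D2 (-D1) = rr D1 D2 := by unfold rr; congr 1; ring
    rw [this, abs_div, abs_of_pos (by positivity : 0 < rr D1 D2 ^ 2)]
    have : |β| / rr D1 D2 ^ 2 * rr D1 D2 = |β| / rr D1 D2 := by field_simp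
    rw [this]
    calc |β| / rr D1 D2 ≤ (1 / N * 8) / (N / 200) := by gcongr
      _ = 1600 / N ^ 2 := by field_simp; norm_num
  have hwD : w1 * D2 - w2 * D1 = β := by
    have : w1 * D2 - w2 * D1 = β / rr D1 D2 ^ 2 * (D1 ^ 2 + D2 ^ 2) := by rw [hw1, hw2]; ring
    rw [this, ← rr_sq]; field_simp
  have hv2 : v1 ^ 2 + v2 ^ 2 = 1 / N ^ 2 := by rw [← rr_sq, hv]; ring
  have hN2 : (1:ℝ) / N ^ 2 ≤ 1 / 10000 ^ 2 := by gcongr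
  have hw2' : w1 ^ 2 + w2 ^ 2 ≤ 1 / N ^ 2 := by
    rw [← rr_sq]
    have e0 : rr w1 w2 ≤ 1 / N := by
      refine hw.trans ?_
      rw [div_le_div_iff₀ (by positivity) (by positivity)]; nlinarith
    calc rr w1 w2 ^ 2 ≤ (1 / N) ^ 2 := pow_le_pow_left₀ (rr_nonneg _ _) e0 2
      _ = 1 / N ^ 2 := by ring
  have t1 := trap pa pb v1 v2 (by rw [hv2]; linarith)
  have t2 := trap pc pd w1 w2 (by linarith)
  rw [dH_self, ← hE1, ← hE2] at t1
  rw [← hD1, ← hD2, hwD] at t2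
  have eβ : v1 * E2 - v2 * E1 = -β := by rw [hβ]; ring
  rw [eβ] at t1
  have hz : ∀ P : H, Up (Up P (-4 * β)) (-4 * -β) = P := by
    intro P; unfold Up; ext <;> simp
  set c := -4 * -β with hc
  rw [← dH_Up _ _ c, hz] at t2
  have u1 := dH_triangle (q 0) (q j) (q (k+1))
  have u2 := dH_triangle (q j) (Up (q (j+1+1)) c) (q (k+1))
  have u3 := dH_triangle (Up (q (j+1+1)) c) (Up (q (n+1)) c) (q (k+1))
  rw [dH_Up] at u3
  have l0 := (h 0 (k+1) (by omega)).1
  have l1 := (h 0 j (by omega)).2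
  have l2 := (h (j+1+1) (n+1) (by omega)).2
  have l3 := (h (n+1+1) k (by omega)).2
  push_cast at l0 l1 l2 l3
  have hk : (k:ℝ) ≤ 2 * N := by
    have : k ≤ 2 * N := by omega
    exact_mod_cast this
  have hNε' : N * ε ≤ 1 / N ^ 2 := by
    rw [le_div_iff₀ (by positivity)]; calc _ = (N:ℝ) ^ 3 * ε := by ring
      _ ≤ 1 := hNε
  have hkε : k * ε ≤ 2 * (N * ε) := by
    have := mul_le_mul_of_nonneg_right hk hε.le
    linarith
  have cs : (dx (q (n+1)) (q (n+1+1)) - dx (q k) (q (k+1))) * w1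
      + (dy (q (n+1)) (q (n+1+1)) - dy (q k) (q (k+1))) * w2 ≤ 5/2 * (1600 / N^2) := by
    have f1 := rr_cs (dx (q (n+1)) (q (n+1+1))) (dy (q (n+1)) (q (n+1+1))) w1 w2
    have f2 := rr_cs (dx (q k) (q (k+1))) (dy (q k) (q (k+1))) (-w1) (-w2)
    rw [rr_neg] at f2
    have f3 := mul_le_mul (s1 (n+1)) hw (rr_nonneg _ _) (by norm_num)
    have f4 := mul_le_mul (s1 k) hw (rr_nonneg _ _) (by norm_num)
    linarith
  have hε2 : ε ≤ N * ε := le_mul_of_one_le_left hε.le (by linarith)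
  have e7 : (7000:ℝ) / N ^ 2 = 7000 * (1 / N ^ 2) := by ring
  have e8 : 5/2 * ((1600:ℝ) / N^2) = 4000 * (1 / N ^ 2) := by ring
  rw [e8] at cs
  rw [e7]
  rw [show j + 2 = j + 1 + 1 from rfl]
  generalize (1:ℝ) / N ^ 2 = y at *
  linarith

/-! ### Part 7: almost straight chains -/

lemma second_diff {ε : ℝ} {q : ℕ → H} (h : Qseq ε q) (hε : 0 < ε) (hε' : ε ≤ 1 / 4) (n N : ℕ)
    (hN : 10000 ≤ N) (hnN : n + 1 ≤ N) (hNε : (N:ℝ) ^ 3 * ε ≤ 1) (j : ℕ) (hj : j + 1 ≤ n) :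
    rr (dx (q (j+1)) (q (j+2)) - dx (q j) (q (j+1)))
      (dy (q (j+1)) (q (j+2)) - dy (q j) (q (j+1))) ≤ 7000 / N := by
  set a := dx (q (j+1)) (q (j+2)) - dx (q j) (q (j+1)) with ha
  set b := dy (q (j+1)) (q (j+2)) - dy (q j) (q (j+1)) with hb
  have hNR : (10000:ℝ) ≤ N := by exact_mod_cast hN
  have hN0 : (0:ℝ) < N := by linarith
  rcases (rr_nonneg a b).eq_or_lt with h0 | h0
  · rw [← h0]; positivity
  have h1 := second_diff_v h hε hε' n N hN hnN hNε j hj (1 / (N * rr a b) * a) (1 / (N * rr a b) * b)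
    (by rw [rr_smul, abs_of_pos (by positivity)]; field_simp)
  rw [← ha, ← hb] at h1
  have e : a * (1 / (N * rr a b) * a) + b * (1 / (N * rr a b) * b) = rr a b / N := by
    have : a * (1 / (N * rr a b) * a) + b * (1 / (N * rr a b) * b)
      = 1 / (N * rr a b) * (a ^ 2 + b ^ 2) := by ring
    rw [this, ← rr_sq]; field_simp
  rw [e, div_le_iff₀ hN0] at h1
  calc rr a b ≤ _ := h1
    _ = 7000 / N := by field_simp

lemma seq_n {ε : ℝ} {q : ℕ → H} (h : Qseq ε q) (hε : 0 < ε) (hε' : ε ≤ 1 / 4) (n : ℕ)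
    (hn : 100 ≤ n) (hnε : (n:ℝ) ^ 6 * ε ≤ 1) :
    (1 - ε) * n ≤ n * rr (dx (q 0) (q 1)) (dy (q 0) (q 1)) + 7000 + 376 * Real.sqrt n := by
  have hnR : (100:ℝ) ≤ n := by exact_mod_cast hn
  have hn0 : (0:ℝ) < n := by linarith
  set a := dx (q 0) (q 1) with ha
  set b := dy (q 0) (q 1) with hb
  have hd : ∀ j, j + 1 ≤ n → rr (dx (q (j+1)) (q (j+2)) - dx (q j) (q (j+1)))
      (dy (q (j+1)) (q (j+2)) - dy (q j) (q (j+1))) ≤ 7000 / n ^ 2 := by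
    intro j hj
    have := second_diff h hε hε' n (n^2) (by nlinarith) (by nlinarith) (by
      push_cast; rw [← pow_mul]; exact hnε) j hj
    push_cast at this
    exact this
  set δ := (7000:ℝ) / n ^ 2 with hδ
  have hδ0 : 0 ≤ δ := by positivity
  have hz : ∀ i, i ≤ n → rr (dx (q i) (q (i+1)) - a) (dy (q i) (q (i+1)) - b) ≤ i * δ := by
    intro i
    induction i with
    | zero => intro _; simp [ha, hb, rr]
    | succ i ih =>
      intro hi
      have e1 := ih (by omega)
      have e2 := hd i hi
      have e3 := rr_add (dx (q i) (q (i+1)) - a) (dy (q i) (q (i+1)) - b)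
        (dx (q (i+1)) (q (i+2)) - dx (q i) (q (i+1)))
        (dy (q (i+1)) (q (i+2)) - dy (q i) (q (i+1)))
      have e4 : dx (q i) (q (i+1)) - a + (dx (q (i+1)) (q (i+2)) - dx (q i) (q (i+1)))
        = dx (q (i+1)) (q (i+1+1)) - a := by ring
      have e5 : dy (q i) (q (i+1)) - b + (dy (q (i+1)) (q (i+2)) - dy (q i) (q (i+1)))
        = dy (q (i+1)) (q (i+1+1)) - b := by ring
      rw [e4, e5] at e3
      push_cast
      linarith
  have hp : ∀ i, i ≤ n → rr (dx (q 0) (q i) - i * a) (dy (q 0) (q i) - i * b) ≤ i ^ 2 * δ := by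
    intro i
    induction i with
    | zero => intro _; simp [dx, dy, rr]
    | succ i ih =>
      intro hi
      have e1 := ih (by omega)
      have e2 := hz i (by omega)
      have e3 := rr_add (dx (q 0) (q i) - i * a) (dy (q 0) (q i) - i * b)
        (dx (q i) (q (i+1)) - a) (dy (q i) (q (i+1)) - b)
      have e4 : dx (q 0) (q i) - i * a + (dx (q i) (q (i+1)) - a)
        = dx (q 0) (q (i+1)) - ((i:ℝ) + 1) * a := by simp only [dx]; ring
      have e5 : dy (q 0) (q i) - i * b + (dy (q i) (q (i+1)) - b)
        = dy (q 0) (q (i+1)) - ((i:ℝ) + 1) * b := by simp only [dy]; ring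
      rw [e4, e5] at e3
      push_cast
      nlinarith [mul_nonneg (Nat.cast_nonneg i : (0:ℝ) ≤ i) hδ0]
  have hnδ : (n:ℝ) ^ 2 * δ = 7000 := by rw [hδ]; field_simp
  have hi2 : ∀ i, i ≤ n → (i:ℝ) ^ 2 * δ ≤ 7000 := by
    intro i hi
    rw [← hnδ]
    have : (i:ℝ) ≤ n := by exact_mod_cast hi
    gcongr
  have s1 : ∀ i, rr (dx (q i) (q (i+1))) (dy (q i) (q (i+1))) ≤ 5 / 4 := fun i => by
    have := rr_dx_le (q i) (q (i+1))
    have := (h.step i).2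
    linarith
  have ht := tt_sum h hε hε' 0 17500 n (by
    intro i hi
    rw [Nat.zero_add]
    have f1 := omega_le ((hp i hi.le).trans (hi2 i hi.le)) (s1 i)
    have f2 := omega_le (s1 0) (hz i hi.le)
    rw [← ha, ← hb] at f2
    have f3 : (i:ℝ) * |a * (dy (q i) (q (i+1)) - b) - b * (dx (q i) (q (i+1)) - a)|
        ≤ i * (5 / 4 * (i * δ)) := mul_le_mul_of_nonneg_left f2 (Nat.cast_nonneg i)
    rw [← abs_of_nonneg (Nat.cast_nonneg i : (0:ℝ) ≤ i), ← abs_mul,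
      abs_of_nonneg (Nat.cast_nonneg i : (0:ℝ) ≤ i)] at f3
    have f4 := hi2 i hi.le
    have f5 : (i:ℝ) * (5 / 4 * (i * δ)) = 5 / 4 * (i ^ 2 * δ) := by ring
    rw [f5] at f3
    rw [abs_le] at *
    constructor <;> linarith [f1.1, f1.2, f3.1, f3.2])
  rw [Nat.zero_add] at ht
  have l := (h 0 n (by omega)).1
  push_cast at l
  have u := nH_le (dx (q 0) (q n)) (dy (q 0) (q n)) (tt (q 0) (q n))
  rw [← dH_eq'] at u
  have p := rr_add (dx (q 0) (q n) - n * a) (dy (q 0) (q n) - n * b) (n * a) (n * b)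
  rw [rr_smul, abs_of_pos hn0, sub_add_cancel, sub_add_cancel] at p
  have p2 := (hp n le_rfl).trans (hi2 n le_rfl)
  have hs : Real.sqrt |tt (q 0) (q n)| ≤ 188 * Real.sqrt n := by
    apply Real.sqrt_le_iff.2
    refine ⟨by positivity, ?_⟩
    rw [mul_pow, Real.sq_sqrt hn0.le]
    linarith
  linarith

lemma seq_main {ε κ : ℝ} {q : ℕ → H} (h : Qseq ε q) (hε : 0 < ε) (hκ : 0 < κ) (hκ' : κ ≤ 1 / 4)
    (hεκ : ε ≤ κ ^ 24) :
    1 - 2200 * κ ^ 2 ≤ rr (dx (q 0) (q 1)) (dy (q 0) (q 1)) ∧ |tt (q 0) (q 1)| ≤ 400 * κ := by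
  have k4 : κ ^ 4 ≤ (1/4)^4 := by gcongr
  have k4p : 0 < κ ^ 4 := by positivity
  have hbig : (256:ℝ) ≤ 1 / κ ^ 4 := by
    rw [le_div_iff₀ k4p]; linarith
  set n := ⌊1 / κ ^ 4⌋₊ with hn
  have n1 : (n:ℝ) ≤ 1 / κ ^ 4 := Nat.floor_le (by positivity)
  have n2 : 1 / κ ^ 4 < n + 1 := Nat.lt_floor_add_one _
  have n3 : 100 ≤ n := by
    have : (100:ℝ) ≤ n := by linarith
    exact_mod_cast this
  have n4 : 1 / (4 * κ ^ 4) ≤ n := by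
    have : 1 / (4 * κ ^ 4) = 1 / κ ^ 4 / 4 := by field_simp
    rw [this]; linarith
  have ε2 : ε ≤ κ ^ 2 / 1000 := by
    have : κ ^ 24 = κ ^ 2 * κ ^ 22 := by ring
    have h22 : κ ^ 22 ≤ (1/4) ^ 22 := by gcongr
    have : κ ^ 2 * κ ^ 22 ≤ κ ^ 2 * (1 / 1000) :=
      mul_le_mul_of_nonneg_left (h22.trans (by norm_num)) (by positivity)
    linarith
  have κ2 : κ ^ 2 ≤ 1 / 16 := by
    calc κ ^ 2 ≤ (1/4) ^ 2 := by gcongr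
      _ = _ := by norm_num
  have hε' : ε ≤ 1 / 4 := by linarith
  have hnε : (n:ℝ) ^ 6 * ε ≤ 1 := by
    calc (n:ℝ) ^ 6 * ε ≤ (1 / κ ^ 4) ^ 6 * κ ^ 24 := by gcongr
      _ = 1 := by field_simp
  have m := seq_n h hε hε' n n3 hnε
  set a := rr (dx (q 0) (q 1)) (dy (q 0) (q 1)) with ha
  set r := Real.sqrt n with hr
  have hrn : r ^ 2 = n := Real.sq_sqrt (by positivity)
  have r1 : 1 / (2 * κ ^ 2) ≤ r := by
    apply Real.le_sqrt_of_sq_le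
    calc (1 / (2 * κ ^ 2)) ^ 2 = 1 / (4 * κ ^ 4) := by field_simp; norm_num
      _ ≤ (n:ℝ) := n4
  have hr0 : 0 < r := lt_of_lt_of_le (by positivity) r1
  have r2 : 1 / r ≤ 2 * κ ^ 2 := by
    rw [div_le_iff₀ (by positivity)] at r1 ⊢
    linarith
  have r10 : 10 ≤ r := by
    apply Real.le_sqrt_of_sq_le
    have : (100:ℝ) ≤ n := by exact_mod_cast n3
    linarith
  rw [← hrn] at m
  have m2 : 1 - ε ≤ a + 1076 * (1 / r) := by
    have : (1 - ε) * r ^ 2 ≤ (a + 1076 * (1 / r)) * r ^ 2 := by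
      have : (a + 1076 * (1 / r)) * r ^ 2 = a * r ^ 2 + 1076 * r := by field_simp
      rw [this]; nlinarith
    exact le_of_mul_le_mul_right this (by positivity)
  have hA : 1 - 2200 * κ ^ 2 ≤ a := by linarith
  refine ⟨hA, ?_⟩
  have t1 := t_sq_le (dx (q 0) (q 1)) (dy (q 0) (q 1)) (tt (q 0) (q 1))
  rw [← dH_eq'] at t1
  have s1 := h.step 0
  rw [Nat.zero_add] at s1
  rw [← ha] at t1
  have s2 : a ≤ dH (q 0) (q 1) := rr_dx_le _ _
  have s3 : dH (q 0) (q 1) ≤ 5/4 := by linarith [s1.2]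
  have s4 : dH (q 0) (q 1) ^ 3 ≤ (5/4) ^ 3 := pow_le_pow_left₀ (dH_nonneg _ _) s3 3
  refine abs_le_of_sq_le_sq ?_ (by positivity)
  refine t1.trans ?_
  calc 32 * dH (q 0) (q 1) ^ 3 * (dH (q 0) (q 1) - a) ≤ 32 * (5/4)^3 * (2201 * κ ^ 2) := by
        apply mul_le_mul (by linarith) (by linarith [s1.2]) (by linarith) (by norm_num)
    _ ≤ (400 * κ) ^ 2 := by nlinarith [sq_nonneg κ]

/-! ### Part 8: images of horizontal segments and projections -/

lemma nH_horiz (x y : ℝ) : nH x y 0 = rr x y := le_antisymm (nH_seg x y) (rr_le_nH x y 0)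

lemma IsBiLip.lower {ε : ℝ} {f : H → H} (h : IsBiLip ε f) (hε : 0 < ε) (P Q : H) :
    (1 - ε) * dH P Q ≤ dH (f P) (f Q) := by
  refine le_trans ?_ (h P Q).1
  apply mul_le_mul_of_nonneg_right _ (dH_nonneg _ _)
  rw [← one_div, le_div_iff₀ (by linarith)]; nlinarith

lemma horiz {ε κ : ℝ} {f : H → H} (h : IsBiLip ε f) (hε : 0 < ε) (hκ : 0 < κ) (hκ' : κ ≤ 1 / 4)
    (hεκ : ε ≤ κ ^ 24) (P : H) (u1 u2 : ℝ) :
    rr u1 u2 * (1 - 2200 * κ ^ 2) ≤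
      rr (dx (f P) (f (Hmul P (u1, u2, 0)))) (dy (f P) (f (Hmul P (u1, u2, 0)))) ∧
    |tt (f P) (f (Hmul P (u1, u2, 0)))| ≤ 400 * κ * rr u1 u2 ^ 2 := by
  rcases (rr_nonneg u1 u2).eq_or_lt with h0 | h0
  · have e := rr_sq u1 u2
    rw [← h0] at e
    have e1 : u1 = 0 := by nlinarith [sq_nonneg u1, sq_nonneg u2]
    have e2 : u2 = 0 := by nlinarith [sq_nonneg u1, sq_nonneg u2]
    subst e1 e2
    have : Hmul P (0, 0, 0) = P := Hmul_HO P
    rw [this, ← h0]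
    refine ⟨by rw [zero_mul]; exact rr_nonneg _ _, by simp [tt]⟩
  set r := rr u1 u2 with hr
  have hrr : rr (1/r) 0 = 1 / r := by
    unfold rr; rw [show (1/r)^2 + 0^2 = (1/r)^2 by ring, Real.sqrt_sq (by positivity)]
  have hd : ∀ i j : ℕ, i ≤ j →
      dH (Hmul P ((i:ℝ) * u1, i * u2, 0)) (Hmul P ((j:ℝ) * u1, j * u2, 0)) = ((j:ℝ) - i) * r := by
    intro i j hij
    have hij' : (i:ℝ) ≤ j := by exact_mod_cast hij
    rw [dH_left, dH_eq]
    simp only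
    have e1 : (j:ℝ) * u1 - i * u1 = (j - i) * u1 := by ring
    have e2 : (j:ℝ) * u2 - i * u2 = (j - i) * u2 := by ring
    have e3 : (0:ℝ) - 0 - 2 * (j * u1 * (i * u2) - i * u1 * (j * u2)) = 0 := by ring
    rw [e1, e2, e3, nH_horiz, rr_smul, abs_of_nonneg (by linarith)]
  have hs : ∀ A B : H, dH (Sim (1/r) 0 1 A) (Sim (1/r) 0 1 B) = 1 / r * dH A B := by
    intro A B
    rw [dH_sim (1/r) 0 1 (by norm_num) (by positivity), hrr]
  have hq : Qseq ε (fun k : ℕ => Sim (1/r) 0 1 (f (Hmul P ((k:ℝ) * u1, k * u2, 0)))) := by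
    intro i j hij
    simp only [hs]
    have a1 := h.lower hε (Hmul P ((i:ℝ) * u1, i * u2, 0)) (Hmul P ((j:ℝ) * u1, j * u2, 0))
    have a2 := (h (Hmul P ((i:ℝ) * u1, i * u2, 0)) (Hmul P ((j:ℝ) * u1, j * u2, 0))).2
    rw [hd i j hij] at a1 a2
    constructor
    · rw [one_div, ← div_eq_inv_mul, le_div_iff₀ h0]; linarith
    · rw [one_div, ← div_eq_inv_mul, div_le_iff₀ h0]; linarith
  have m := seq_main hq hε hκ hκ' hεκ
  simp only [Nat.cast_zero, Nat.cast_one, zero_mul, one_mul] at m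
  have e0 : Hmul P (0, 0, 0) = P := Hmul_HO P
  rw [e0] at m
  set Q := f (Hmul P (u1, u2, 0))
  set F := f P
  have x1 : dx (Sim (1/r) 0 1 F) (Sim (1/r) 0 1 Q) = 1 / r * dx F Q := by
    simp only [dx, Sim]; ring
  have x2 : dy (Sim (1/r) 0 1 F) (Sim (1/r) 0 1 Q) = 1 / r * dy F Q := by
    simp only [dy, Sim]; ring
  have x3 : tt (Sim (1/r) 0 1 F) (Sim (1/r) 0 1 Q) = (1 / r) ^ 2 * tt F Q := by
    simp only [tt, Sim]; ring
  rw [x1, x2, x3, rr_smul, abs_mul, abs_of_pos (by positivity : 0 < 1 / r),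
    abs_of_pos (by positivity : 0 < (1 / r) ^ 2)] at m
  obtain ⟨m1, m2⟩ := m
  constructor
  · have := mul_le_mul_of_nonneg_left m1 h0.le
    calc _ ≤ _ := this
      _ = _ := by field_simp
  · have := mul_le_mul_of_nonneg_left m2 (sq_nonneg r)
    calc |tt F Q| = r ^ 2 * ((1 / r) ^ 2 * |tt F Q|) := by field_simp
      _ ≤ _ := this
      _ = _ := by ring

lemma far (Z1 Z2 τ x y t : ℝ) (hR : 100 ≤ rr Z1 Z2) (hw : rr x y ≤ 20) (ht : |t| ≤ 2400)
    (hτ : |τ| ≤ 400) :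
    rr Z1 Z2 - (x * Z1 + y * Z2) / rr Z1 Z2 ≤ dH (x, y, t) (Z1, Z2, τ) ∧
    dH (x, y, t) (Z1, Z2, τ) ≤ rr Z1 Z2 - (x * Z1 + y * Z2) / rr Z1 Z2 + 41000 / rr Z1 Z2 := by
  rw [dH_eq]
  simp only
  set R := rr Z1 Z2 with hRdef
  have hR0 : 0 < R := by linarith
  have hR2 : R ^ 2 = Z1 ^ 2 + Z2 ^ 2 := rr_sq Z1 Z2
  set I := (x * Z1 + y * Z2) / R with hI
  have hIR : I * R = x * Z1 + y * Z2 := by rw [hI]; field_simp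
  have hI1 : I ≤ 20 := by
    rw [hI, div_le_iff₀ hR0]
    exact (rr_cs x y Z1 Z2).trans (mul_le_mul_of_nonneg_right hw hR0.le)
  set ρ := rr (Z1 - x) (Z2 - y) with hρ
  have hρ2 : ρ ^ 2 = (Z1 - x) ^ 2 + (Z2 - y) ^ 2 := rr_sq _ _
  have low : R - I ≤ ρ := by
    have c := rr_cs (Z1 - x) (Z2 - y) Z1 Z2
    rw [← hρ, ← hRdef] at c
    have : (R - I) * R ≤ ρ * R := by
      calc (R - I) * R = R ^ 2 - I * R := by ring
        _ = (Z1 - x) * Z1 + (Z2 - y) * Z2 := by rw [hR2, hIR]; ring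
        _ ≤ _ := c
    exact le_of_mul_le_mul_right this hR0
  refine ⟨low.trans (rr_le_nH _ _ _), ?_⟩
  have hρR : R / 2 ≤ ρ := by linarith
  have hρ0 : 0 < ρ := by linarith
  have up : ρ ≤ R - I + 400 / R := by
    apply rr_le_of (by have : 0 < 400 / R := by positivity
                       linarith)
    have e1 : x ^ 2 + y ^ 2 ≤ 400 := by
      rw [← rr_sq]; nlinarith [rr_nonneg x y]
    have e2 : (R - I + 400 / R) ^ 2 = R ^ 2 - 2 * (I * R) + I ^ 2 + 2 * (R - I) * (400 / R) + (400 / R) ^ 2 := by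
      ring
    have e3 : 400 ≤ 2 * (R - I) * (400 / R) := by
      rw [← mul_div_assoc, le_div_iff₀ hR0]; nlinarith
    rw [e2, hR2, hIR]
    nlinarith [sq_nonneg I, sq_nonneg (400 / R)]
  set T := τ - t - 2 * (Z1 * y - x * Z2) with hT
  have hTle : |T| ≤ 70 * R := by
    have c := omega_le hw (le_refl (rr Z1 Z2))
    rw [← hRdef] at c
    have e : T = τ - t + 2 * (x * Z2 - y * Z1) := by rw [hT]; ring
    rw [e]
    rw [abs_le] at *
    constructor <;> linarith [c.1, c.2, ht.1, ht.2, hτ.1, hτ.2]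
  have u := nH_upper (Z1 - x) (Z2 - y) T hρ0
  rw [← hρ] at u
  have hT2 : T ^ 2 ≤ (70 * R) ^ 2 := by
    rw [← sq_abs]; exact pow_le_pow_left₀ (abs_nonneg _) hTle 2
  have q : T ^ 2 / (2 * ρ ^ 3) ≤ 40000 / R := by
    calc T ^ 2 / (2 * ρ ^ 3) ≤ (70 * R) ^ 2 / (2 * (R / 2) ^ 3) := by gcongr
      _ = 19600 / R := by field_simp; norm_num
      _ ≤ 40000 / R := by gcongr; norm_num
  have : (41000:ℝ) / R = 40000 / R + 400 / R + 600 / R := by ring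
  have : 0 < 600 / R := by positivity
  linarith

lemma proj {ε s : ℝ} {f : H → H} (h : IsBiLip ε f) (hf : f HO = HO) (hε : 0 < ε) (hs : 0 < s)
    (hs' : s ≤ 1 / 1000) (hεs : ε ≤ s ^ 48) (u1 u2 : ℝ) (hu : rr u1 u2 = 1) :
    ∃ e1 e2 : ℝ, rr e1 e2 = 1 ∧ ∀ P : H, dH HO P ≤ 10 →
      |((f P).1 * e1 + (f P).2.1 * e2) - (P.1 * u1 + P.2.1 * u2)| ≤ 90000 * s := by
  have ε3 : ε ≤ s ^ 3 * (1 / 10) := by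
    have : s ^ 48 = s ^ 3 * s ^ 45 := by ring
    have h45 : s ^ 45 ≤ (1/1000) ^ 45 := by gcongr
    have : s ^ 3 * s ^ 45 ≤ s ^ 3 * (1/10) :=
      mul_le_mul_of_nonneg_left (h45.trans (by norm_num)) (by positivity)
    linarith
  have s2 : s ^ 2 ≤ s * (1 / 1000) := by
    have : s ^ 2 = s * s := by ring
    rw [this]; gcongr
  have s3 : s ^ 3 ≤ s * (1 / 1000000) := by
    have : s ^ 3 = s ^ 2 * s := by ring
    nlinarith
  set N := 1 / s with hN
  have hNs : N * s = 1 := by rw [hN]; field_simp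
  have hN0 : 0 < N := by positivity
  have hN1000 : 1000 ≤ N := by rw [hN, le_div_iff₀ hs]; linarith
  have εN : ε * N ≤ s * (1 / 1000) := by
    have : ε * N ≤ s ^ 3 * (1 / 10) * N := by gcongr
    have e : s ^ 3 * (1/10) * N = s ^ 2 * (1 / 10) * (N * s) := by ring
    rw [e, hNs] at this
    linarith [sq_nonneg s]
  have hz := horiz h hε (κ := s ^ 2) (by positivity) (by linarith) (by
    rw [← pow_mul]; exact hεs) HO (N * u1) (N * u2)
  rw [rr_smul, hu, abs_of_pos hN0, mul_one, hf] at hz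
  have hQ : Hmul HO (N * u1, N * u2, 0) = (N * u1, N * u2, 0) := by
    unfold Hmul HO; ext <;> simp
  rw [hQ] at hz
  have hup := (h HO (N * u1, N * u2, 0)).2
  have hOQ : dH HO (N * u1, N * u2, 0) = N := by
    have := nH_horiz (N * u1) (N * u2)
    rw [rr_smul, hu, abs_of_pos hN0, mul_one] at this
    exact this
  rw [hOQ, hf] at hup
  obtain ⟨⟨Z1, Z2, τ⟩, hfQ⟩ : ∃ Q', f (N * u1, N * u2, 0) = Q' := ⟨_, rfl⟩
  rw [hfQ] at hz hup
  have hZ := (rr_le_nH Z1 Z2 τ).trans hup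
  simp only [dx, dy, tt, HO, sub_zero, mul_zero, zero_mul] at hz
  obtain ⟨hz1, hz2⟩ := hz
  have hτ : |τ| ≤ 400 := by
    calc |τ| ≤ _ := hz2
      _ = 400 * (N * s) ^ 2 := by ring
      _ = 400 := by rw [hNs]; norm_num
  set R := rr Z1 Z2 with hR
  have hR1 : N - s ≤ R := by
    have : N * (1 - 2200 * (s ^ 2) ^ 2) = N - 2200 * s ^ 3 * (N * s) := by ring
    rw [this, hNs] at hz1
    linarith
  have hR2 : R ≤ N + s := by linarith
  have hR0 : 0 < R := by linarith
  have hRinv : 41000 / R ≤ 82000 * s := by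
    rw [div_le_iff₀ hR0]
    nlinarith
  have hNinv : 41000 / N = 41000 * s := by rw [hN]; field_simp
  refine ⟨Z1 / R, Z2 / R, ?_, ?_⟩
  · rw [div_eq_inv_mul, div_eq_inv_mul, rr_smul, abs_of_pos (by positivity), ← hR]; field_simp
  intro P hP
  have bd : ∀ W : H, dH HO W ≤ 20 → rr W.1 W.2.1 ≤ 20 ∧ |W.2.2| ≤ 2400 := by
    intro W hW
    have a1 : rr W.1 W.2.1 ≤ dH HO W := rr_le_nH W.1 W.2.1 W.2.2
    have a2 : |W.2.2| ≤ 6 * dH HO W ^ 2 := abs_t_le W.1 W.2.1 W.2.2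
    have := dH_nonneg HO W
    exact ⟨by linarith, by nlinarith⟩
  have bP := bd P (by linarith)
  have hε1 : ε ≤ 1 := by linarith [s3]
  have hfP : dH HO (f P) ≤ 20 := by
    have := (h HO P).2
    rw [hf] at this
    nlinarith [dH_nonneg HO P]
  have bF := bd (f P) hfP
  have A := far (N * u1) (N * u2) 0 P.1 P.2.1 P.2.2 (by rw [rr_smul, hu, abs_of_pos hN0]; linarith)
    bP.1 bP.2 (by simp)
  have B := far Z1 Z2 τ (f P).1 (f P).2.1 (f P).2.2 (by linarith) bF.1 bF.2 hτ
  rw [rr_smul, hu, abs_of_pos hN0, mul_one, hNinv] at A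
  rw [← hR] at B
  have e1 : (P.1 * (N * u1) + P.2.1 * (N * u2)) / N = P.1 * u1 + P.2.1 * u2 := by field_simp
  have e2 : ((f P).1 * Z1 + (f P).2.1 * Z2) / R = (f P).1 * (Z1 / R) + (f P).2.1 * (Z2 / R) := by ring
  rw [e1] at A
  rw [e2] at B
  have hb := (h P (N * u1, N * u2, 0)).2
  have hl := h.lower hε P (N * u1, N * u2, 0)
  rw [hfQ] at hb hl
  have htri := dH_triangle P HO (N * u1, N * u2, 0)
  rw [hOQ, dH_comm P HO] at htri
  change _ ≤ dH P (N * u1, N * u2, 0) ∧ dH P (N * u1, N * u2, 0) ≤ _ at A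
  change _ ≤ dH (f P) (Z1, Z2, τ) ∧ dH (f P) (Z1, Z2, τ) ≤ _ at B
  have hεd : ε * dH P (N * u1, N * u2, 0) ≤ s := by
    calc ε * dH P (N * u1, N * u2, 0) ≤ ε * (10 + N) := by gcongr; linarith
      _ ≤ s := by linarith
  rw [abs_le]
  constructor <;> linarith [A.1, A.2, B.1, B.2]

/-! ### Part 9: conclusion -/

set_option maxHeartbeats 1000000 in
lemma planar {ε ρ : ℝ} {f : H → H} (h : IsBiLip ε f) (hf : f HO = HO) (hε : 0 < ε) (hρ : 0 < ρ)
    (hρ' : ρ ≤ 1 / 400) (hερ : ε ≤ (ρ ^ 2) ^ 48) :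
    ∃ p q σ : ℝ, rr p q = 1 ∧ σ ^ 2 = 1 ∧ ∀ P : H, dH HO P ≤ 10 →
      rr ((f P).1 - (p * P.1 - σ * q * P.2.1)) ((f P).2.1 - (q * P.1 + σ * p * P.2.1)) ≤ 21000 * ρ := by
  have hs : ρ ^ 2 ≤ 1 / 160000 := by nlinarith
  have hε2 : ε ≤ ρ ^ 2 := by
    refine hερ.trans ?_
    exact pow_le_of_le_one (by positivity) (by linarith) (by norm_num)
  obtain ⟨p, q, hpq, hP⟩ := proj h hf hε (s := ρ ^ 2) (by positivity) (by linarith) hερ 1 0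
    (by simp [rr])
  obtain ⟨p', q', hpq', hP'⟩ := proj h hf hε (s := ρ ^ 2) (by positivity) (by linarith) hερ 0 1
    (by simp [rr])
  simp only [mul_one, mul_zero, add_zero, zero_add] at hP hP'
  have n1 : p ^ 2 + q ^ 2 = 1 := by rw [← rr_sq, hpq]; norm_num
  have n2 : p' ^ 2 + q' ^ 2 = 1 := by rw [← rr_sq, hpq']; norm_num
  have sρ : 90000 * ρ ^ 2 ≤ 225 * ρ := by nlinarith
  set c := p * p' + q * q' with hc
  set d := p * q' - q * p' with hd
  have hcd : c ^ 2 + d ^ 2 = 1 := by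
    have : c ^ 2 + d ^ 2 = (p ^ 2 + q ^ 2) * (p' ^ 2 + q' ^ 2) := by rw [hc, hd]; ring
    rw [this, n1, n2]; norm_num
  -- almost orthogonality
  have hc1 : |c| ≤ 1000 * ρ := by
    have d1 : dH HO ((0:ℝ), (1:ℝ), (0:ℝ)) = 1 := by
      have := nH_horiz 0 1
      simp only [rr] at this
      norm_num at this
      exact this
    have a1 := hP (0, 1, 0) (by rw [d1]; norm_num)
    have a2 := hP' (0, 1, 0) (by rw [d1]; norm_num)
    have a3 := (h HO (0, 1, 0)).2
    rw [hf, d1] at a3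
    set F1 := (f (0, 1, 0)).1
    set F2 := (f (0, 1, 0)).2.1
    have a4 : rr F1 F2 ≤ (1 + ε) * 1 := (rr_le_nH F1 F2 _).trans a3
    simp only [sub_zero] at a1 a2
    have a5 : F1 ^ 2 + F2 ^ 2 ≤ 1 + 3 * ρ ^ 2 := by
      rw [← rr_sq]; nlinarith [rr_nonneg F1 F2]
    have a6 : (F1 - p') ^ 2 + (F2 - q') ^ 2 ≤ (500 * ρ) ^ 2 := by
      rw [abs_le] at a2
      nlinarith [a2.1]
    have a7 := rr_le_of (by positivity) a6
    have a8 := rr_cs p q (F1 - p') (F2 - q')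
    have a9 := rr_cs (-p) (-q) (F1 - p') (F2 - q')
    rw [rr_neg] at a9
    rw [hpq, one_mul] at a8 a9
    rw [abs_le] at *
    constructor <;> linarith [a1.1, a1.2]
  have hc2 : c ^ 2 ≤ (1000 * ρ) ^ 2 := by
    rw [← sq_abs]; exact pow_le_pow_left₀ (abs_nonneg _) hc1 2
  obtain ⟨σ, hσ, hσd⟩ : ∃ σ : ℝ, σ ^ 2 = 1 ∧ σ * d = |d| := by
    rcases le_total 0 d with h0 | h0
    · exact ⟨1, by norm_num, by rw [abs_of_nonneg h0, one_mul]⟩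
    · exact ⟨-1, by norm_num, by rw [abs_of_nonpos h0]; ring⟩
  have hd1 : 1 - c ^ 2 ≤ σ * d := by
    rw [hσd]
    have : |d| ^ 2 = d ^ 2 := sq_abs d
    nlinarith [abs_nonneg d, sq_nonneg c]
  have hdiff : rr (p' + σ * q) (q' - σ * p) ≤ 1500 * ρ := by
    apply rr_le_of (by positivity)
    have : (p' + σ * q) ^ 2 + (q' - σ * p) ^ 2
      = (p' ^ 2 + q' ^ 2) + σ ^ 2 * (p ^ 2 + q ^ 2) - 2 * (σ * d) := by rw [hd]; ring
    rw [this, n1, n2, hσ]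
    nlinarith
  refine ⟨p, q, σ, hpq, hσ, fun P hPd => ?_⟩
  have a1 := hP P hPd
  have a2 := hP' P hPd
  have a3 := (h HO P).2
  rw [hf] at a3
  set F1 := (f P).1
  set F2 := (f P).2.1
  have a4 : rr F1 F2 ≤ 11 := by
    have : rr F1 F2 ≤ (1 + ε) * dH HO P := (rr_le_nH F1 F2 _).trans a3
    nlinarith [dH_nonneg HO P]
  have b1 := rr_cs F1 F2 (p' + σ * q) (q' - σ * p)
  have b2 := rr_cs (-F1) (-F2) (p' + σ * q) (q' - σ * p)
  rw [rr_neg] at b2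
  have b3 := mul_le_mul a4 hdiff (rr_nonneg _ _) (by norm_num)
  set G1 := F1 * p + F2 * q - P.1 with hG1
  set G2 := -(F1 * (σ * q)) + F2 * (σ * p) - P.2.1 with hG2
  have g1 : |G1| ≤ 225 * ρ := a1.trans sρ
  have g2 : |G2| ≤ 17000 * ρ := by
    rw [abs_le] at *
    constructor <;> linarith [a2.1, a2.2]
  apply rr_le_of (by positivity)
  have key : (F1 - (p * P.1 - σ * q * P.2.1)) ^ 2 + (F2 - (q * P.1 + σ * p * P.2.1)) ^ 2
      = G1 ^ 2 + G2 ^ 2 := by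
    have hσ2 : σ * σ = 1 := by rw [← sq]; exact hσ
    have k1 : F1 - (p * P.1 - σ * q * P.2.1) = p * G1 - σ * q * G2 := by
      have : p * G1 - σ * q * G2 = F1 * (p ^ 2 + σ ^ 2 * q ^ 2) + F2 * p * q * (1 - σ ^ 2)
        - (p * P.1 - σ * q * P.2.1) := by rw [hG1, hG2]; ring
      rw [this, hσ, one_mul, n1]; ring
    have k2 : F2 - (q * P.1 + σ * p * P.2.1) = q * G1 + σ * p * G2 := by
      have : q * G1 + σ * p * G2 = F2 * (q ^ 2 + σ ^ 2 * p ^ 2) + F1 * p * q * (1 - σ ^ 2)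
        - (q * P.1 + σ * p * P.2.1) := by rw [hG1, hG2]; ring
      rw [this, hσ, one_mul, add_comm (q ^ 2), n1]; ring
    rw [k1, k2]
    have : (p * G1 - σ * q * G2) ^ 2 + (q * G1 + σ * p * G2) ^ 2
      = (p ^ 2 + q ^ 2) * G1 ^ 2 + σ ^ 2 * (p ^ 2 + q ^ 2) * G2 ^ 2 := by ring
    rw [this, hσ, n1]; ring
  rw [key, ← sq_abs G1, ← sq_abs G2]
  nlinarith [abs_nonneg G1, abs_nonneg G2]

set_option maxHeartbeats 1000000 in
lemma unit_case {ε ρ : ℝ} {f : H → H} (h : IsBiLip ε f) (hf : f HO = HO) (hε : 0 < ε) (hρ : 0 < ρ)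
    (hρ' : ρ ≤ 1 / 400) (hερ : ε ≤ (ρ ^ 2) ^ 48) :
    ∃ p q σ : ℝ, rr p q = 1 ∧ σ ^ 2 = 1 ∧ ∀ P : H, dH HO P ≤ 1 →
      dH (f P) (Sim p q σ P) ≤ 30000 * Real.sqrt ρ := by
  obtain ⟨p, q, σ, hpq, hσ, hF⟩ := planar h hf hε hρ hρ' hερ
  refine ⟨p, q, σ, hpq, hσ, ?_⟩
  have hs : ρ ^ 2 ≤ 1 / 160000 := by nlinarith
  have hε2 : ε ≤ ρ ^ 2 := by
    refine hερ.trans ?_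
    exact pow_le_of_le_one (by positivity) (by linarith) (by norm_num)
  have n1 : p ^ 2 + q ^ 2 = 1 := by rw [← rr_sq, hpq]; norm_num
  have hA : ∀ x y, rr (p * x - σ * q * y) (q * x + σ * p * y) = rr x y := by
    intro x y
    unfold rr; congr 1
    have : (p * x - σ * q * y) ^ 2 + (q * x + σ * p * y) ^ 2
      = (p ^ 2 + q ^ 2) * x ^ 2 + σ ^ 2 * (p ^ 2 + q ^ 2) * y ^ 2 := by ring
    rw [this, hσ, n1]; ring
  have hFb : ∀ P, dH HO P ≤ 10 → rr (f P).1 (f P).2.1 ≤ 11 := by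
    intro P hP
    have a3 := (h HO P).2
    rw [hf] at a3
    have : rr (f P).1 (f P).2.1 ≤ (1 + ε) * dH HO P := (rr_le_nH _ _ _).trans a3
    nlinarith [dH_nonneg HO P]
  have hAb : ∀ P, dH HO P ≤ 10 → rr (p * P.1 - σ * q * P.2.1) (q * P.1 + σ * p * P.2.1) ≤ 10 := by
    intro P hP
    rw [hA]
    have : rr P.1 P.2.1 ≤ dH HO P := rr_le_nH _ _ _
    linarith
  have step : ∀ (P : H) (u1 u2 E : ℝ), dH HO P + rr u1 u2 ≤ 10 → |(f P).2.2 - σ * P.2.2| ≤ E →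
      dH HO (Hmul P (u1, u2, 0)) ≤ dH HO P + rr u1 u2 ∧
      |(f (Hmul P (u1, u2, 0))).2.2 - σ * (Hmul P (u1, u2, 0)).2.2| ≤ E + 1000000 * ρ := by
    intro P u1 u2 E hd hE
    have hu0 := rr_nonneg u1 u2
    have hP0 := dH_nonneg HO P
    have t1 := dH_triangle HO P (Hmul P (u1, u2, 0))
    have t2 : dH P (Hmul P (u1, u2, 0)) = rr u1 u2 := by
      conv_lhs => rw [← Hmul_HO P]
      rw [Hmul_HO P]
      have : dH (Hmul P HO) (Hmul P (u1, u2, 0)) = rr u1 u2 := by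
        rw [dH_left]; exact nH_horiz u1 u2
      rwa [Hmul_HO] at this
    rw [t2] at t1
    refine ⟨t1, ?_⟩
    have hz := (horiz h hε (κ := (ρ ^ 2) ^ 2) (by positivity) (by nlinarith [sq_nonneg ρ]) (by
      rw [← pow_mul]; exact hερ) P u1 u2).2
    have hQt : (Hmul P (u1, u2, 0)).2.2 = P.2.2 - 2 * (P.1 * (Hmul P (u1, u2, 0)).2.1
        - P.2.1 * (Hmul P (u1, u2, 0)).1) := by simp only [Hmul]; ring
    set Q := Hmul P (u1, u2, 0) with hQ
    have FP := hF P (by linarith)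
    have FQ := hF Q (by linarith)
    have w1 := omega_le FP (hFb Q (by linarith))
    have w2 := omega_le (hAb P (by linarith)) FQ
    have hsm : 400 * (ρ ^ 2) ^ 2 * rr u1 u2 ^ 2 ≤ ρ := by
      have e1 : rr u1 u2 ^ 2 ≤ 100 := by nlinarith
      have e2 : (ρ ^ 2) ^ 2 ≤ ρ / 1000000 := by
        have : ρ ^ 3 ≤ (1 / 400) ^ 3 := by gcongr
        have : (ρ ^ 2) ^ 2 = ρ * ρ ^ 3 := by ring
        nlinarith
      calc 400 * (ρ ^ 2) ^ 2 * rr u1 u2 ^ 2 ≤ 400 * (ρ / 1000000) * 100 := by gcongr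
        _ ≤ ρ := by linarith
    have key : (f Q).2.2 - σ * Q.2.2 = ((f P).2.2 - σ * P.2.2) + tt (f P) (f Q)
        - 2 * (((f P).1 - (p * P.1 - σ * q * P.2.1)) * (f Q).2.1
          - ((f P).2.1 - (q * P.1 + σ * p * P.2.1)) * (f Q).1)
        - 2 * ((p * P.1 - σ * q * P.2.1) * ((f Q).2.1 - (q * Q.1 + σ * p * Q.2.1))
          - (q * P.1 + σ * p * P.2.1) * ((f Q).1 - (p * Q.1 - σ * q * Q.2.1))) := by
      have e : (p * P.1 - σ * q * P.2.1) * (q * Q.1 + σ * p * Q.2.1)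
          - (q * P.1 + σ * p * P.2.1) * (p * Q.1 - σ * q * Q.2.1)
          = σ * (p ^ 2 + q ^ 2) * (P.1 * Q.2.1 - P.2.1 * Q.1) := by ring
      rw [n1, mul_one] at e
      simp only [tt]
      linear_combination (-σ) * hQt - 2 * e
    rw [key]
    rw [abs_le] at *
    constructor <;> linarith [hE.1, hE.2, w1.1, w1.2, w2.1, w2.2, hz.1, hz.2]
  intro P hP
  obtain ⟨x, y, t⟩ := P
  have hr1 : rr x y ≤ 1 := (rr_le_nH x y t).trans hP
  have ht6 : |t| ≤ 6 := by
    have := abs_t_le x y t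
    have h0 := nH_nonneg x y t
    have hP' : nH x y t ≤ 1 := hP
    nlinarith
  obtain ⟨a, b, ha, hb, hab⟩ : ∃ a b : ℝ, |a| ≤ 2 ∧ |b| ≤ 2 ∧ -4 * (a * b) = t := by
    have h0 := Real.sqrt_nonneg |t|
    have h1 : Real.sqrt |t| ≤ 4 := Real.sqrt_le_iff.2 ⟨by norm_num, by linarith⟩
    have h2 := Real.mul_self_sqrt (abs_nonneg t)
    have hh : |Real.sqrt |t| / 2| ≤ 2 := by rw [abs_of_nonneg (by positivity)]; linarith
    rcases le_total 0 t with h3 | h3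
    · refine ⟨Real.sqrt |t| / 2, -(Real.sqrt |t| / 2), hh, by rwa [abs_neg], ?_⟩
      rw [abs_of_nonneg h3] at *; linarith
    · refine ⟨Real.sqrt |t| / 2, Real.sqrt |t| / 2, hh, hh, ?_⟩
      rw [abs_of_nonpos h3] at *; linarith
  have ra : ∀ a : ℝ, rr a 0 = |a| := by intro a; simp [rr, Real.sqrt_sq_eq_abs]
  have rb : ∀ a : ℝ, rr 0 a = |a| := by intro a; simp [rr, Real.sqrt_sq_eq_abs]
  have z0 : dH HO HO = 0 := dH_self _
  have s1 := step HO a 0 0 (by rw [z0, ra]; linarith) (by rw [hf]; simp [HO])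
  rw [z0, ra] at s1
  have s2 := step _ 0 b _ (by rw [rb]; linarith [s1.1]) s1.2
  rw [rb] at s2
  have s3 := step _ (-a) 0 _ (by rw [ra, abs_neg]; linarith [s1.1, s2.1]) s2.2
  rw [ra, abs_neg] at s3
  have s4 := step _ 0 (-b) _ (by rw [rb, abs_neg]; linarith [s1.1, s2.1, s3.1]) s3.2
  rw [rb, abs_neg] at s4
  have s5 := step _ x y _ (by linarith [s1.1, s2.1, s3.1, s4.1]) s4.2
  have hend : Hmul (Hmul (Hmul (Hmul (Hmul HO (a, 0, 0)) (0, b, 0)) (-a, 0, 0)) (0, -b, 0)) (x, y, 0)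
      = (x, y, t) := by
    rw [← hab]
    simp only [Hmul, HO, Prod.mk.injEq]
    refine ⟨by ring, by ring, by ring⟩
  rw [hend] at s5
  have s6 := s5.2
  have FP := hF (x, y, t) (by linarith)
  have AP := hAb (x, y, t) (by linarith)
  simp only at FP AP s6
  have w := omega_le FP AP
  rw [dH_eq']
  refine (nH_le _ _ _).trans ?_
  have r1 : rr (dx (f (x, y, t)) (Sim p q σ (x, y, t))) (dy (f (x, y, t)) (Sim p q σ (x, y, t)))
      ≤ 21000 * ρ := by
    rw [← rr_neg]
    simp only [dx, dy, Sim, neg_sub]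
    exact FP
  have r2 : |tt (f (x, y, t)) (Sim p q σ (x, y, t))| ≤ 2400 ^ 2 * ρ := by
    have e : tt (f (x, y, t)) (Sim p q σ (x, y, t)) = -((f (x, y, t)).2.2 - σ * t)
      + 2 * (((f (x, y, t)).1 - (p * x - σ * q * y)) * (q * x + σ * p * y)
        - ((f (x, y, t)).2.1 - (q * x + σ * p * y)) * (p * x - σ * q * y)) := by
      simp only [tt, Sim]
      linear_combination σ * t * n1
    rw [e]
    rw [abs_le] at *
    constructor <;> linarith [w.1, w.2, s6.1, s6.2]
  have r3 : Real.sqrt |tt (f (x, y, t)) (Sim p q σ (x, y, t))| ≤ 2400 * Real.sqrt ρ := by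
    apply Real.sqrt_le_iff.2
    refine ⟨by positivity, ?_⟩
    rw [mul_pow, Real.sq_sqrt hρ.le]; exact r2
  have r4 : ρ ≤ Real.sqrt ρ := by
    apply Real.le_sqrt_of_sq_le; nlinarith
  linarith

/-- Theorem D, pointwise approximation by isometries.
There exist `ε₀ > 0` and `C > 0` such that if `0 < ε < ε₀`, `f` is a
`(1+ε)`-biLipschitz map of `ℍ`, `R > 0` and `P₀ ∈ ℍ`, then there exists an
isometry `T` of `(ℍ, d)` such that `d(f(P), T(P)) ≤ C ε^{1/2048} R` whenever
`d(P, P₀) ≤ R`. -/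
theorem statement5 :
    ∃ ε₀ > (0:ℝ), ∃ C > (0:ℝ),
      ∀ ε : ℝ, 0 < ε → ε < ε₀ →
      ∀ f : H → H, IsBiLip ε f →
      ∀ R : ℝ, 0 < R → ∀ P₀ : H,
        ∃ T : H → H, Function.Bijective T ∧ (∀ P Q : H, dH (T P) (T Q) = dH P Q) ∧
          ∀ P : H, dH P P₀ ≤ R → dH (f P) (T P) ≤ C * ε ^ ((1:ℝ)/2048) * R := by
  refine ⟨(1/20) ^ 2048, by positivity, 30000, by norm_num, ?_⟩
  intro ε hε hε0 f hf R hR P₀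
  set η := ε ^ ((1:ℝ)/2048) with hη
  have η0 : 0 < η := Real.rpow_pos_of_pos hε _
  have ηε : η ^ 2048 = ε := by
    rw [hη, ← Real.rpow_natCast, ← Real.rpow_mul hε.le]
    norm_num
  have η1 : η ≤ 1 / 20 := by
    by_contra! hc
    have : (1/20 : ℝ) ^ 2048 ≤ η ^ 2048 := pow_le_pow_left₀ (by norm_num) hc.le _
    rw [ηε] at this
    exact absurd hε0 (not_lt.2 this)
  have hinv : ∀ A : H, Sim R 0 1 (Sim (1/R) 0 1 A) = A := by
    intro A
    have := hR.ne'
    simp only [Sim]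
    ext <;> simp <;> field_simp
  have hd : ∀ c : ℝ, 0 < c → ∀ A B : H, dH (Sim c 0 1 A) (Sim c 0 1 B) = c * dH A B := by
    intro c hc A B
    rw [dH_sim c 0 1 (by norm_num) (by positivity)]
    congr 1
    unfold rr; rw [show c^2 + 0^2 = c^2 by ring, Real.sqrt_sq hc.le]
  set g : H → H := fun P => Sim (1/R) 0 1 (Hmul (Hinv (f P₀)) (f (Hmul P₀ (Sim R 0 1 P)))) with hg
  have hg0 : g HO = HO := by
    have e : Hmul (Hinv (f P₀)) (f P₀) = HO := by
      have := Hinv_mul_cancel (f P₀) HO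
      rwa [Hmul_HO] at this
    simp only [hg, Sim_HO, Hmul_HO, e]
  have hgb : IsBiLip ε g := by
    intro P Q
    have hc := hf (Hmul P₀ (Sim R 0 1 P)) (Hmul P₀ (Sim R 0 1 Q))
    rw [dH_left, hd R hR] at hc
    simp only [hg]
    rw [hd (1/R) (by positivity), dH_left]
    rw [one_div_mul_eq_div, le_div_iff₀ hR, div_le_iff₀ hR]
    exact ⟨by linarith [hc.1], by linarith [hc.2]⟩
  have hη2 : η ^ 2 ≤ 1 / 400 := by nlinarith
  obtain ⟨p, q, σ, hpq, hσ, hmain⟩ := unit_case hgb hg0 hε (ρ := η ^ 2) (by positivity) hη2 (by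
    rw [← pow_mul, ← pow_mul]
    calc ε = η ^ 2048 := ηε.symm
      _ ≤ η ^ (2 * 2 * 48) := pow_le_pow_of_le_one η0.le (by linarith) (by norm_num))
  rw [Real.sqrt_sq η0.le] at hmain
  have n1 : p ^ 2 + q ^ 2 = 1 := by rw [← rr_sq, hpq]; norm_num
  have left : ∀ A : H, Sim p (-σ * q) σ (Sim p q σ A) = A := by
    intro A
    have := sim_inv p q σ hσ (by rw [n1]; norm_num) A
    rwa [n1, div_one, div_one] at this
  have right : ∀ A : H, Sim p q σ (Sim p (-σ * q) σ A) = A := by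
    intro A
    have hσ' : σ * (σ * q) = q := by rw [← mul_assoc, ← sq, hσ, one_mul]
    have n2 : p ^ 2 + (-σ * q) ^ 2 = 1 := by rw [mul_pow, neg_sq, hσ, one_mul, n1]
    have := sim_inv p (-σ * q) σ hσ (by rw [n2]; norm_num) A
    rw [n2, div_one, div_one, show -σ * (-σ * q) = σ * (σ * q) by ring, hσ'] at this
    exact this
  refine ⟨fun P => Hmul (f P₀) (Sim p q σ (Hmul (Hinv P₀) P)), ?_, ?_, ?_⟩
  · rw [Function.bijective_iff_has_inverse]
    refine ⟨fun P => Hmul P₀ (Sim p (-σ * q) σ (Hmul (Hinv (f P₀)) P)), fun P => ?_, fun P => ?_⟩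
    · simp only [Hinv_mul_cancel, left, Hmul_inv_cancel]
    · simp only [Hinv_mul_cancel, right, Hmul_inv_cancel]
  · intro P Q
    rw [dH_left, dH_sim p q σ hσ (by rw [n1]; norm_num), hpq, one_mul, dH_left]
  · intro P hP
    set W := Sim (1/R) 0 1 (Hmul (Hinv P₀) P) with hW
    have hRW : Sim R 0 1 W = Hmul (Hinv P₀) P := hinv _
    have hWd : dH HO W ≤ 1 := by
      have e : dH HO W = 1 / R * dH P₀ P := by
        have : HO = Sim (1/R) 0 1 HO := (Sim_HO _ _ _).symm
        rw [this, hW, hd (1/R) (by positivity)]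
        have e2 : dH HO (Hmul (Hinv P₀) P) = dH P₀ P := by
          rw [← dH_left P₀ HO, Hmul_HO, Hmul_inv_cancel]
        rw [e2]
      rw [e, dH_comm, one_div, ← div_eq_inv_mul, div_le_iff₀ hR]; linarith
    have m := hmain W hWd
    have e1 : f P = Hmul (f P₀) (Sim R 0 1 (g W)) := by
      simp only [hg, hinv, hRW, Hmul_inv_cancel]
    have e2 : Sim p q σ (Hmul (Hinv P₀) P) = Sim R 0 1 (Sim p q σ W) := by
      rw [← hRW]
      simp only [Sim]
      ext <;> simp <;> ring
    simp only
    rw [e1, e2, dH_left, hd R hR]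
    calc R * dH (g W) (Sim p q σ W) ≤ R * (30000 * η) := mul_le_mul_of_nonneg_left m hR.le
      _ = _ := by ring
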